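/- arXiv:1809.10957 — 3 statements merged into one kernel-verified Lean document; each statement's English description precedes it below -/
import Mathlib

section
/- Every irreducible 𝕂-linear representation ψ of a finite p-group G can be expressed in the form ψ = ind_{H/K}^G(φ), where K ⊴ H ≤ G, the subquotient H/K is a Roquette p-group, and φ is a faithful 𝕂(H/K)-irrep that is not isomorphic to a representation induced from any proper subgroup of H/K. -/
open scoped Classical

noncomputable section

namespace Genotype

variable {k : Type} [Field k] {G : Type} [Group G]

/-- The subfield generated (over the prime field `ℚ`) by the values of a function,
e.g. the field `ℚ[ψ]` generated by the values of a character. -/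
def charField {X : Type} {k : Type} [Field k] (f : X → k) : Subfield k :=
  Subfield.closure (Set.range f)

theorem mem_charField {X : Type} {k : Type} [Field k] (f : X → k) (x : X) :
    f x ∈ charField f :=
  Subfield.subset_closure ⟨x, rfl⟩

/-- Two functions (typically characters of irreps over possibly different
characteristic-zero fields) are Galois conjugate: there is a Galois extension `M` of `ℚ`
containing (copies of) all their values and a field automorphism `α` of `M` with
`α (f g) = f' g` for all `g`. -/
def IsGaloisConj {k l : Type} [Field k] [Field l] {G : Type}
    (f : G → k) (f' : G → l) : Prop :=
  ∃ (M : Type) (_ : Field M) (_ : Algebra ℚ M), IsGalois ℚ M ∧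
    ∃ (i : charField f →+* M) (j : charField f' →+* M) (α : M ≃+* M),
      ∀ g : G, α (i ⟨f g, mem_charField f g⟩) = j ⟨f' g, mem_charField f' g⟩

/-- Irreducibility of a finite-dimensional representation. -/
def IsIrr (V : FDRep k G) : Prop :=
  Nontrivial V ∧
    ∀ U : Submodule k V, (∀ g : G, ∀ x ∈ U, V.ρ g x ∈ U) → U = ⊥ ∨ U = ⊤

/-- Faithfulness of a representation. -/
def IsFaithfulRep (V : FDRep k G) : Prop := Function.Injective V.ρ

/-- `f` (the character of an irrep) occurs in the character `c`,
i.e. `c = f + (character of some representation)`. -/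
def CharOccurs (f c : G → k) : Prop :=
  ∃ W : FDRep k G, c = f + W.character

/-- `f` (the character of an irrep) occurs in `c` with multiplicity exactly `m`. -/
def CharMult (f c : G → k) (m : ℕ) : Prop :=
  ∃ W : FDRep k G, c = m • f + W.character ∧ ¬ CharOccurs f W.character

/-- `f` is the character of an irreducible representation. -/
def IsIrrChar (f : G → k) : Prop := ∃ V : FDRep k G, IsIrr V ∧ f = V.character

/-- Restriction of a character to a subgroup. -/
def resChar (H : Subgroup G) (c : G → k) : H → k := fun h => c h

/-- The induced character `ind_H^G f`. -/
def indChar (H : Subgroup G) (f : H → k) : G → k := fun g =>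
  (Nat.card H : k)⁻¹ *
    ∑ᶠ x : G, if h : x⁻¹ * g * x ∈ H then f ⟨x⁻¹ * g * x, h⟩ else 0

/-- The character `cψ` (of a `kG`-irrep) is tightly induced from the character `cφ`
(of a `kH`-irrep): `cψ` is the induced character of `cφ`, `cφ` occurs with multiplicity
exactly `1` in the restriction of `cψ`, and no Galois conjugate of `cφ` other than `cφ`
itself occurs in the restriction of `cψ`. -/
def TightInd (H : Subgroup G) (cψ : G → k) (cφ : H → k) : Prop :=
  cψ = indChar H cφ ∧ CharMult cφ (resChar H cψ) 1 ∧
    ∀ cφ' : H → k, IsIrrChar cφ' → IsGaloisConj cφ cφ' →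
      CharOccurs cφ' (resChar H cψ) → cφ' = cφ

/-- Tight induction from a subquotient `H/K` of `G`: tight induction from `H`
of the inflation. -/
def TightIndSub (H : Subgroup G) (K : Subgroup H) [K.Normal]
    (cψ : G → k) (cφ : (H ⧸ K) → k) : Prop :=
  TightInd H cψ (fun h => cφ (QuotientGroup.mk h))

/-- A group is Roquette if every normal abelian subgroup of it is cyclic. -/
def IsRoquette (P : Type) [Group P] : Prop :=
  ∀ A : Subgroup P, A.Normal → (∀ x ∈ A, ∀ y ∈ A, x * y = y * x) → IsCyclic A

/-- `χ` is the rational form `ψ_ℚ` of `V`: a rational irrep such that `V` occurs in the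
scalar extension `k ⊗_ℚ χ`. -/
def IsRatForm [CharZero k] (χ : FDRep ℚ G) (V : FDRep k G) : Prop :=
  IsIrr χ ∧ CharOccurs V.character (fun g => algebraMap ℚ k (χ.character g))

/-- Irreps over possibly different characteristic-zero fields are quasiconjugate if they
determine the same rational irrep. -/
def Quasiconj {k l : Type} [Field k] [Field l] [CharZero k] [CharZero l] {G : Type} [Group G]
    (V : FDRep k G) (W : FDRep l G) : Prop :=
  ∃ χ : FDRep ℚ G, IsRatForm χ V ∧ IsRatForm χ W

end Genotype

namespace Genotype

/-- extension by zero -/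
def extZ {k : Type} [Field k] {G : Type} [Group G] (H : Subgroup G) (f : H → k) (y : G) : k :=
  if h : y ∈ H then f ⟨y, h⟩ else 0

theorem indChar_eq {k : Type} [Field k] {G : Type} [Group G] [Fintype G] (H : Subgroup G)
    (f : H → k) (g : G) :
    indChar H f g = (Nat.card H : k)⁻¹ * ∑ x : G, extZ H f (x⁻¹ * g * x) := by
  unfold indChar extZ
  rw [finsum_eq_sum_of_fintype]

theorem extZ_coe {k : Type} [Field k] {G : Type} [Group G] (H : Subgroup G) (f : H → k) (y : H) :
    extZ H f y = f y := by
  simp [extZ]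

theorem sum_extZ {k : Type} [Field k] {G : Type} [Group G] [Fintype G] (H : Subgroup G)
    (f : H → k) (u : G → k) :
    ∑ g : G, u g * extZ H f g = ∑ h : H, u h * f h := by
  have h1 : ∑ g : G, u g * extZ H f g = ∑ g with g ∈ H, u g * extZ H f g := by
    rw [Finset.sum_filter]
    refine Finset.sum_congr rfl fun g _ => ?_
    by_cases hg : g ∈ H <;> simp [extZ, hg]
  rw [h1, Finset.sum_subtype (p := fun g => g ∈ H) _ (by simp)]
  exact Finset.sum_congr rfl fun h _ => by rw [extZ_coe]

theorem semisimple_idem (R : Type) [CommRing R] [IsSemisimpleRing R] [Nontrivial R] :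
    ∃ e : R, e * e = e ∧ e ≠ 0 ∧ (∀ a, a * a = a → a * e = 0 ∨ a * e = e) ∧
      (e = 1 → IsDomain R) := by
  obtain ⟨I, hI⟩ := Ideal.exists_maximal R
  obtain ⟨f, hf, hIf⟩ := IsSemisimpleRing.ideal_eq_span_idempotent I
  have hff : f * f = f := hf
  have key : ∀ a ∈ I, a * (1 - f) = 0 := by
    intro a ha
    rw [hIf] at ha
    obtain ⟨b, rfl⟩ := Ideal.mem_span_singleton'.1 ha
    rw [mul_assoc, mul_sub, hff]; simp
  refine ⟨1 - f, by ring_nf; rw [pow_two, hff]; ring, ?_, ?_, ?_⟩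
  · intro h
    have : f = 1 := (sub_eq_zero.1 h).symm
    apply hI.ne_top
    rw [hIf, this, Ideal.span_singleton_one]
  · intro a ha
    have h0 : a * (1 - a) ∈ I := by rw [mul_sub, ha]; simp
    rcases hI.isPrime.mem_or_mem h0 with h | h
    · exact Or.inl (key _ h)
    · right
      have := key _ h
      linear_combination -this
  · intro h
    have : f = 0 := by simpa using h
    have hb : I = ⊥ := by rw [hIf, this]; simp
    have := hI.isPrime
    rw [hb] at this
    exact IsDomain.of_bot_isPrime R

theorem idem_induced {k : Type} [Field k] [CharZero k] {P : Type} [Group P] [Fintype P]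
    (V : FDRep k P) (hV : IsIrr V) (e : Module.End k V) (he : e * e = e) (he0 : e ≠ 0)
    (T : Subgroup P) (hT : ∀ x, x ∈ T ↔ V.ρ x * e * V.ρ x⁻¹ = e)
    (horth : ∀ x, x ∉ T → e * (V.ρ x * e * V.ρ x⁻¹) = 0) :
    ∃ θ : FDRep k T, V.character = indChar T θ.character := by
  set ρ : P →* Module.End k V := V.ρ with hρ
  have inv1 : ∀ x, ρ x * ρ x⁻¹ = 1 := fun x => by rw [← map_mul]; simp
  have inv2 : ∀ x, ρ x⁻¹ * ρ x = 1 := fun x => by rw [← map_mul]; simp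
  set c : P → Module.End k V := fun x => ρ x * e * ρ x⁻¹ with hc
  have hcm : ∀ g x, ρ g * c x = c (g * x) * ρ g := by
    intro g x
    simp only [hc, mul_inv_rev, map_mul, mul_assoc, inv2, mul_one]
  set s : Module.End k V := ∑ x, c x with hs
  have hcs : ∀ g, ρ g * s = s * ρ g := by
    intro g
    rw [hs, Finset.mul_sum, Finset.sum_mul]
    simp_rw [hcm]
    exact Fintype.sum_equiv (Equiv.mulLeft g) _ _ fun x => rfl
  have hes : e * s = (Nat.card T : k) • e := by
    rw [hs, Finset.mul_sum]
    have : ∀ x, e * c x = if x ∈ T then e else 0 := by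
      intro x
      split_ifs with h
      · have := (hT x).1 h
        simp only [hc]; rw [this, he]
      · exact horth x h
    simp_rw [this]
    rw [← Finset.sum_filter, Finset.sum_const, ← Nat.cast_smul_eq_nsmul k]
    congr 2
    rw [Nat.card_eq_fintype_card, Fintype.card_subtype]
  have hcxs : ∀ x, c x * s = (Nat.card T : k) • c x := by
    intro x
    simp only [hc]
    rw [mul_assoc, hcs, ← mul_assoc, mul_assoc (ρ x), hes]
    simp
  have hss : s * s = (Nat.card T : k) • s := by
    conv_lhs => rw [hs, Finset.sum_mul]
    simp_rw [← hs, hcxs]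
    rw [← Finset.smul_sum]
  have hcard : (Nat.card T : k) ≠ 0 := by exact_mod_cast Nat.card_pos.ne'
  have hs0 : s ≠ 0 := by
    intro h
    rw [h, mul_zero] at hes
    exact (smul_ne_zero hcard he0) hes.symm
  have hrange : LinearMap.range s = ⊤ := by
    rcases hV.2 (LinearMap.range s) (by
      rintro g _ ⟨v, rfl⟩
      exact ⟨ρ g v, (LinearMap.congr_fun (hcs g) v).symm⟩) with h | h
    · exact absurd (LinearMap.range_eq_bot.1 h) hs0
    · exact h
  have hsT : s = (Nat.card T : k) • (1 : Module.End k V) := by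
    ext v
    obtain ⟨w, rfl⟩ := LinearMap.range_eq_top.1 hrange v
    exact LinearMap.congr_fun hss w
  have hTe : ∀ t ∈ T, ρ t * e = e * ρ t := by
    intro t ht
    have := (hT t).1 ht
    conv_rhs => rw [← this]
    rw [mul_assoc, inv2, mul_one]
  let σ : Subrepresentation ((V.ρ.comp T.subtype : T →* _) : Representation k T V) :=
    { toSubmodule := LinearMap.range e
      apply_mem_toSubmodule := by
        rintro t _ ⟨v, rfl⟩
        exact ⟨ρ t v, (LinearMap.congr_fun (hTe t t.2) v).symm⟩ }
  refine ⟨FDRep.of σ.toRepresentation, ?_⟩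
  have hθ : ∀ t : T, (FDRep.of σ.toRepresentation).character t
      = LinearMap.trace k V (ρ t * e) := by
    intro t
    rw [← LinearMap.trace_restrict_eq_of_forall_mem (LinearMap.range e) (ρ t * e)
      (fun v => ⟨ρ t v, (LinearMap.congr_fun (hTe t t.2) v).symm⟩)
      (fun v _ => ⟨ρ t v, (LinearMap.congr_fun (hTe t t.2) v).symm⟩)]
    unfold FDRep.character
    congr 1
    ext ⟨_, v, rfl⟩
    change ρ t (e v) = ρ t (e (e v))
    rw [← Module.End.mul_apply e e, he]
  have hext : ∀ y, extZ T (FDRep.of σ.toRepresentation).character y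
      = LinearMap.trace k V (ρ y * e) := by
    intro y
    by_cases h : y ∈ T
    · simp only [extZ, h, dif_pos]
      exact hθ ⟨y, h⟩
    · simp only [extZ, h, dif_neg, not_false_eq_true]
      symm
      have h1 : e * (ρ y * e) = 0 := by
        have := horth y h
        have h2 : e * (ρ y * e * ρ y⁻¹) * ρ y = 0 := by
          rw [this, zero_mul]
        rwa [mul_assoc, mul_assoc, inv2, mul_one] at h2
      rw [← he, ← mul_assoc, LinearMap.trace_mul_comm, h1, map_zero]
  ext g
  rw [indChar_eq, eq_inv_mul_iff_mul_eq₀ hcard]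
  simp_rw [hext]
  have h1 : (Nat.card T : k) * V.character g = LinearMap.trace k V (ρ g * s) := by
    rw [hsT]; simp [FDRep.character, hρ]
  rw [h1, hs, Finset.mul_sum, map_sum]
  refine Finset.sum_congr rfl fun x _ => ?_
  simp only [hc, map_mul]
  rw [← mul_assoc, ← mul_assoc, LinearMap.trace_mul_comm]
  simp only [mul_assoc]

theorem roquette_of_primitive {k : Type} [Field k] [CharZero k] {P : Type} [Group P] [Fintype P]
    (V : FDRep k P) (hV : IsIrr V) (hf : IsFaithfulRep V)
    (hprim : ∀ L : Subgroup P, L ≠ ⊤ → ∀ θ : FDRep k L, V.character ≠ indChar L θ.character) :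
    IsRoquette P := by
  intro A hA hcomm
  have := hV.1
  set ρ : P →* Module.End k V := V.ρ with hρ
  have inv1 : ∀ x, ρ x * ρ x⁻¹ = 1 := fun x => by rw [← map_mul]; simp
  have inv2 : ∀ x, ρ x⁻¹ * ρ x = 1 := fun x => by rw [← map_mul]; simp
  let F : MonoidAlgebra k A →ₐ[k] Module.End k V := MonoidAlgebra.lift k _ A (ρ.comp A.subtype)
  have hF : ∀ a : A, F (MonoidAlgebra.of k A a) = ρ a := by
    intro a
    simp [F]
  let R := F.range
  have hmc : ∀ a b : MonoidAlgebra k A, a * b = b * a := by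
    intro a b
    letI : CommGroup A := { (inferInstance : Group A) with
      mul_comm := fun x y => Subtype.ext (hcomm x x.2 y y.2) }
    exact mul_comm a b
  letI : CommRing R := { (inferInstance : Ring R) with
    mul_comm := by
      rintro ⟨_, a, rfl⟩ ⟨_, b, rfl⟩
      apply Subtype.ext
      change F a * F b = F b * F a
      rw [← map_mul, hmc, map_mul] }
  haveI : NeZero (Nat.card A : k) := ⟨by exact_mod_cast Nat.card_pos.ne'⟩
  haveI : IsSemisimpleRing R :=
    RingHom.isSemisimpleRing_of_surjective (F.rangeRestrict : MonoidAlgebra k A →+* R)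
      F.rangeRestrict_surjective
  haveI : Nontrivial R := inferInstance
  obtain ⟨e, he, he0, hprime, hdom⟩ := semisimple_idem R
  have hconj : ∀ x : P, ∀ r : R, ρ x * r * ρ x⁻¹ ∈ R := by
    rintro x ⟨_, a, rfl⟩
    change ρ x * F a * ρ x⁻¹ ∈ R
    induction a using MonoidAlgebra.induction_on with
    | of a =>
      rw [hF, ← map_mul, ← map_mul]
      exact ⟨MonoidAlgebra.of k A ⟨x * a * x⁻¹, hA.conj_mem a a.2 x⟩, hF _⟩
    | add a b ha hb =>
      rw [map_add, mul_add, add_mul]; exact R.add_mem ha hb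
    | smul r a ha =>
      rw [map_smul, mul_smul_comm, smul_mul_assoc]; exact R.smul_mem ha r
  have hee : (e : Module.End k V) * e = e := congrArg Subtype.val he
  let T : Subgroup P :=
    { carrier := {x | ρ x * (e : Module.End k V) = e * ρ x}
      one_mem' := by simp
      mul_mem' := by
        intro a b ha hb
        simp only [Set.mem_ofPred_eq, map_mul] at *
        rw [mul_assoc, hb, ← mul_assoc, ha, mul_assoc]
      inv_mem' := by
        intro a ha
        simp only [Set.mem_ofPred_eq] at *
        calc ρ a⁻¹ * (e : Module.End k V) = ρ a⁻¹ * (e * ρ a) * ρ a⁻¹ := by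
              rw [mul_assoc, mul_assoc, inv1, mul_one]
          _ = _ := by rw [← ha, ← mul_assoc, inv2, one_mul] }
  have hT : ∀ x, x ∈ T ↔ ρ x * e * ρ x⁻¹ = (e : Module.End k V) := by
    intro x
    change ρ x * (e : Module.End k V) = e * ρ x ↔ _
    constructor
    · intro h; rw [h, mul_assoc, inv1, mul_one]
    · intro h
      conv_rhs => rw [← h]
      rw [mul_assoc, inv2, mul_one]
  have hidem : ∀ x, (ρ x * e * ρ x⁻¹) * (ρ x * e * ρ x⁻¹) = ρ x * (e : Module.End k V) * ρ x⁻¹ := by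
    intro x
    calc _ = ρ x * e * (ρ x⁻¹ * ρ x) * e * ρ x⁻¹ := by simp only [mul_assoc]
      _ = _ := by rw [inv2, mul_one, mul_assoc (ρ x), hee]
  -- either orthogonal or absorbs
  have hdich : ∀ x, (ρ x * e * ρ x⁻¹) * e = (0 : Module.End k V) ∨
      (ρ x * e * ρ x⁻¹) * e = (e : Module.End k V) := by
    intro x
    rcases hprime ⟨_, hconj x e⟩ (Subtype.ext (hidem x)) with h | h
    · exact Or.inl (congrArg Subtype.val h)
    · exact Or.inr (congrArg Subtype.val h)
  have hcomm2 : ∀ x, (ρ x * e * ρ x⁻¹) * e = (e : Module.End k V) * (ρ x * e * ρ x⁻¹) := by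
    intro x
    exact congrArg Subtype.val (mul_comm (⟨_, hconj x e⟩ : R) e)
  have horth : ∀ x, x ∉ T → (e : Module.End k V) * (ρ x * e * ρ x⁻¹) = 0 := by
    intro x hx
    rw [← hcomm2]
    rcases hdich x with h | h
    · exact h
    exfalso
    apply hx
    rw [hT]
    rcases hdich x⁻¹ with h' | h'
    · exfalso
      rw [inv_inv] at h'
      have : (e : Module.End k V) = 0 := by
        rw [← h, hcomm2]
        calc _ = (e * ρ x) * e * ρ x⁻¹ := by simp only [mul_assoc]
          _ = ρ x * (ρ x⁻¹ * e * ρ x * e) * ρ x⁻¹ := by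
            simp only [← mul_assoc, inv1, one_mul]
          _ = 0 := by rw [h']; simp
      exact he0 (Subtype.ext this)
    · rw [inv_inv] at h'
      calc ρ x * e * ρ x⁻¹ = ρ x * (ρ x⁻¹ * e * ρ x * e) * ρ x⁻¹ := by rw [h']
        _ = e * (ρ x * e * ρ x⁻¹) := by simp only [← mul_assoc, inv1, one_mul]
        _ = e := by rw [← hcomm2, h]
  have hTtop : T = ⊤ := by
    by_contra hne
    obtain ⟨θ, hθ⟩ := idem_induced V hV (e : Module.End k V) hee
      (fun h => he0 (Subtype.ext h)) T hT horth
    exact hprim T hne θ hθ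
  have hce : ∀ x, ρ x * (e : Module.End k V) = e * ρ x := fun x => by
    have : x ∈ T := by rw [hTtop]; trivial
    exact this
  have he1 : e = 1 := by
    rcases hV.2 (LinearMap.range (e : Module.End k V)) (by
      rintro g _ ⟨v, rfl⟩
      exact ⟨ρ g v, (LinearMap.congr_fun (hce g) v).symm⟩) with h | h
    · exact absurd (Subtype.ext (LinearMap.range_eq_bot.1 h)) he0
    · apply Subtype.ext
      ext v
      obtain ⟨w, rfl⟩ := LinearMap.range_eq_top.1 h v
      exact LinearMap.congr_fun hee w
  haveI := hdom he1
  let j : A →* R :=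
    { toFun := fun a => ⟨ρ a, MonoidAlgebra.of k A a, hF a⟩
      map_one' := Subtype.ext (by simp)
      map_mul' := fun a b => Subtype.ext (by simp) }
  refine isCyclic_of_injective_ringHom j ?_
  intro a b hab
  exact Subtype.ext (hf (congrArg Subtype.val hab))

theorem span_dim {k : Type} [Field k] {G : Type} [Group G] [Fintype G]
    (V : FDRep k G) (hV : IsIrr V) (H : Subgroup G) (S : Submodule k V)
    (hS : ∀ h ∈ H, ∀ v ∈ S, V.ρ h v ∈ S) (hS0 : S ≠ ⊥) :
    Module.finrank k V ≤ Nat.card (G ⧸ H) * Module.finrank k S := by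
  let Φ : ((G ⧸ H) → S) →ₗ[k] V :=
    ∑ q : G ⧸ H, (V.ρ q.out ∘ₗ S.subtype) ∘ₗ LinearMap.proj q
  have hΦ : ∀ u, Φ u = ∑ q : G ⧸ H, V.ρ q.out (u q) := by
    intro u; simp [Φ]
  have hmem : ∀ g : G, ∀ v ∈ S, V.ρ g v ∈ LinearMap.range Φ := by
    intro g v hv
    obtain ⟨h, hh⟩ := QuotientGroup.mk_out_eq_mul H g
    have hv' : V.ρ (h⁻¹ : G) v ∈ S := hS _ (H.inv_mem h.2) v hv
    refine ⟨Pi.single (g : G ⧸ H) ⟨_, hv'⟩, ?_⟩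
    rw [hΦ, Finset.sum_eq_single (g : G ⧸ H)]
    · rw [Pi.single_eq_same, hh]
      rw [← Module.End.mul_apply, ← map_mul]
      simp
    · intro b _ hb
      rw [Pi.single_eq_of_ne hb]; simp
    · simp
  have htop : LinearMap.range Φ = ⊤ := by
    rcases hV.2 (LinearMap.range Φ) (by
      rintro g _ ⟨u, rfl⟩
      rw [hΦ, map_sum]
      refine Submodule.sum_mem _ fun q _ => ?_
      rw [← Module.End.mul_apply, ← map_mul]
      exact hmem _ _ (u q).2) with h | h
    · exfalso
      apply hS0
      rw [eq_bot_iff, ← h]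
      intro v hv
      simpa using hmem 1 v hv
    · exact h
  have := LinearMap.finrank_le_finrank_of_surjective (LinearMap.range_eq_top.1 htop)
  rwa [Module.finrank_pi_fintype, Finset.sum_const, Finset.card_univ, smul_eq_mul,
    ← Nat.card_eq_fintype_card] at this

theorem irr_of_induced {k : Type} [Field k] [CharZero k] {G : Type} [Group G] [Fintype G]
    (ψ : FDRep k G) (hψ : IsIrr ψ) (H : Subgroup G) (φ : FDRep k H)
    (h : ψ.character = indChar H φ.character) : IsIrr φ := by
  have hψn := hψ.1
  have hH0 : (Nat.card H : k) ≠ 0 := by exact_mod_cast Nat.card_pos.ne'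
  have hG0 : (Nat.card G : k) ≠ 0 := by exact_mod_cast Nat.card_pos.ne'
  have hdim : Module.finrank k ψ = Nat.card (G ⧸ H) * Module.finrank k φ := by
    have h1 := congrFun h 1
    rw [indChar_eq, FDRep.char_one] at h1
    have : ∀ x : G, extZ H φ.character (x⁻¹ * 1 * x) = Module.finrank k φ := by
      intro x
      rw [mul_one, inv_mul_cancel, ← H.coe_one, extZ_coe, FDRep.char_one]
    simp_rw [this] at h1
    rw [Finset.sum_const, Finset.card_univ, ← Nat.card_eq_fintype_card, nsmul_eq_mul,
      H.card_eq_card_quotient_mul_card_subgroup] at h1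
    push_cast at h1
    have h2 : (Module.finrank k ψ : k) = Nat.card (G ⧸ H) * Module.finrank k φ := by
      rw [h1]; field_simp
    exact_mod_cast h2
  -- Frobenius reciprocity
  have hfrob : ∑ g : G, ψ.character g⁻¹ * ψ.character g =
      (Nat.card H : k)⁻¹ * (Nat.card G * ∑ y : H, ψ.character (y : G)⁻¹ * φ.character y) := by
    have h1 : ∀ g, ψ.character g⁻¹ * ψ.character g = (Nat.card H : k)⁻¹ *
        ∑ x : G, ψ.character (x⁻¹ * g * x)⁻¹ * extZ H φ.character (x⁻¹ * g * x) := by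
      intro g
      conv_lhs => rw [congrFun h g, indChar_eq, mul_left_comm, Finset.mul_sum]
      congr 1
      refine Finset.sum_congr rfl fun x _ => ?_
      congr 1
      have := FDRep.char_conj ψ g⁻¹ x⁻¹
      rw [← this]
      congr 1
      group
    simp_rw [h1]
    rw [← Finset.mul_sum, Finset.sum_comm]
    congr 1
    rw [← sum_extZ H φ.character (fun g => ψ.character g⁻¹)]
    have h2 : ∀ x : G, ∑ g : G, ψ.character (x⁻¹ * g * x)⁻¹ * extZ H φ.character (x⁻¹ * g * x)
        = ∑ g : G, ψ.character g⁻¹ * extZ H φ.character g := by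
      intro x
      refine Fintype.sum_equiv (MulAut.conj x⁻¹).toEquiv _ _ fun g => ?_
      simp
    simp_rw [h2]
    rw [Finset.sum_const, Finset.card_univ, ← Nat.card_eq_fintype_card, nsmul_eq_mul]
  letI : Invertible (Nat.card G : k) := invertibleOfNonzero hG0
  letI : Invertible (Nat.card H : k) := invertibleOfNonzero hH0
  let ρ : Representation k G ψ := ψ.ρ
  let σ : Representation k H φ := φ.ρ
  let τ : Representation k H ψ := ψ.ρ.comp H.subtype
  have hne : ∑ g : G, ψ.character g⁻¹ * ψ.character g ≠ 0 := by
    intro h0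
    have h1 := Representation.card_inv_mul_sum_char_eq_finrank (Representation.linHom ρ ρ)
    simp_rw [Representation.char_linHom] at h1
    have h2 : ∑ g : G, ρ.character g⁻¹ * ρ.character g = 0 := h0
    rw [h2, mul_zero] at h1
    have h3 : Module.finrank k (Representation.linHom ρ ρ).invariants = 0 := by
      exact_mod_cast h1.symm
    have h4 := Submodule.finrank_eq_zero.1 h3
    have h5 : (LinearMap.id : ψ →ₗ[k] ψ) ∈ (Representation.linHom ρ ρ).invariants := by
      rw [Representation.mem_invariants]
      intro g
      rw [Representation.linHom_apply]
      ext v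
      change ρ g (ρ g⁻¹ v) = v
      simp
    rw [h4, Submodule.mem_bot] at h5
    obtain ⟨v, hv⟩ := exists_ne (0 : ψ)
    exact hv (LinearMap.congr_fun h5 v)
  have hne2 : ∑ y : H, φ.character y⁻¹ * ψ.character (y : G) ≠ 0 := by
    intro h0
    apply hne
    rw [hfrob]
    have : ∑ y : H, ψ.character (y : G)⁻¹ * φ.character y
        = ∑ y : H, φ.character y⁻¹ * ψ.character (y : G) := by
      refine Fintype.sum_equiv (Equiv.inv H) _ _ fun y => ?_
      simp [mul_comm]
    rw [this, h0]; simp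
  obtain ⟨f, hf, hf0⟩ : ∃ f : φ →ₗ[k] ψ, (∀ y : H, ∀ v, f (φ.ρ y v) = ψ.ρ (y : G) (f v)) ∧
      f ≠ 0 := by
    have h1 := Representation.card_inv_mul_sum_char_eq_finrank (Representation.linHom σ τ)
    simp_rw [Representation.char_linHom] at h1
    have h2 : (Representation.linHom σ τ).invariants ≠ ⊥ := by
      intro hb
      rw [hb] at h1
      simp only [finrank_bot, Nat.cast_zero, mul_eq_zero, inv_eq_zero, hH0, false_or] at h1
      exact hne2 h1
    obtain ⟨f, hfm, hf0⟩ := Submodule.exists_mem_ne_zero_of_ne_bot h2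
    refine ⟨f, ?_, hf0⟩
    intro y v
    have h3 := (Representation.mem_invariants _ _).1 hfm y
    rw [Representation.linHom_apply] at h3
    have h4 := LinearMap.congr_fun h3 (σ y v)
    have h5 : τ y (f (σ y⁻¹ (σ y v))) = f (σ y v) := h4
    rw [Representation.inv_self_apply] at h5
    exact h5.symm
  have hpos : 0 < Nat.card (G ⧸ H) := Nat.card_pos
  have hinj : Function.Injective f := by
    have h1 := span_dim ψ hψ H (LinearMap.range f) (by
      rintro y hy _ ⟨v, rfl⟩
      exact ⟨φ.ρ ⟨y, hy⟩ v, hf ⟨y, hy⟩ v⟩) (fun hb => hf0 (LinearMap.range_eq_bot.1 hb))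
    rw [hdim] at h1
    have h2 := Nat.le_of_mul_le_mul_left h1 hpos
    have h3 := LinearMap.finrank_range_add_finrank_ker f
    have h4 : Module.finrank k (LinearMap.ker f) = 0 := by omega
    exact LinearMap.ker_eq_bot.1 (Submodule.finrank_eq_zero.1 h4)
  constructor
  · by_contra hn
    rw [not_nontrivial_iff_subsingleton] at hn
    exact hf0 (LinearMap.ext fun v => by rw [Subsingleton.elim v 0]; simp)
  · intro U hU
    by_cases hU0 : U = ⊥
    · exact Or.inl hU0
    right
    have h1 := span_dim ψ hψ H (U.map f) (by
      rintro y hy _ ⟨v, hv, rfl⟩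
      exact ⟨φ.ρ ⟨y, hy⟩ v, hU _ _ hv, hf ⟨y, hy⟩ v⟩) (fun hb => by
        apply hU0
        rw [eq_bot_iff]
        intro v hv
        have : f v ∈ U.map f := ⟨v, hv, rfl⟩
        rw [hb, Submodule.mem_bot] at this
        exact hinj (by rw [this, map_zero]))
    rw [hdim] at h1
    have h2 := (Nat.le_of_mul_le_mul_left h1 hpos).trans (Submodule.finrank_map_le f U)
    exact Submodule.eq_top_of_finrank_eq (le_antisymm (Submodule.finrank_le U) h2)

theorem sum_mk {k : Type} [Field k] [CharZero k] {H : Type} [Group H] [Fintype H]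
    (K : Subgroup H) [K.Normal] : ∃ c : k, c ≠ 0 ∧ ∀ f : (H ⧸ K) → k,
      ∑ h : H, f (QuotientGroup.mk h) = c * ∑ q, f q := by
  have hsurj := QuotientGroup.mk'_surjective K
  let N : ℕ := (Finset.univ.filter fun h : H => QuotientGroup.mk' K h = 1).card
  have hN : ∀ q, (Finset.univ.filter fun h : H => QuotientGroup.mk' K h = q).card = N := by
    intro q
    exact MonoidHom.card_fiber_eq_of_mem_range (QuotientGroup.mk' K) (hsurj q) (hsurj 1)
  refine ⟨N, ?_, ?_⟩
  · have : 0 < N := Finset.card_pos.2 ⟨1, by simp⟩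
    exact_mod_cast this.ne'
  · intro f
    rw [← Finset.sum_fiberwise Finset.univ (QuotientGroup.mk' K), Finset.mul_sum]
    refine Finset.sum_congr rfl fun q _ => ?_
    refine (Finset.sum_congr rfl (g := fun _ => f q)
      (fun h hh => congrArg f (Finset.mem_filter.1 hh).2)).trans ?_
    rw [Finset.sum_const, hN, nsmul_eq_mul]

/-- Induction along inflation. -/
theorem indChar_infl {k : Type} [Field k] [CharZero k] {H : Type} [Group H] [Fintype H]
    (K : Subgroup H) [K.Normal] (L : Subgroup (H ⧸ K)) (θ : L → k) (g : H) :
    indChar L θ (QuotientGroup.mk g) =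
      indChar (L.comap (QuotientGroup.mk' K)) (fun y => θ ⟨QuotientGroup.mk (y : H), y.2⟩) g := by
  obtain ⟨c, hc, hsum⟩ := sum_mk (k := k) K
  have hext : ∀ (η : L → k) (h : H), extZ (L.comap (QuotientGroup.mk' K))
      (fun y => η ⟨QuotientGroup.mk (y : H), y.2⟩) h = extZ L η (QuotientGroup.mk h) := by
    intro η h
    rfl
  have hcard : (Nat.card (L.comap (QuotientGroup.mk' K)) : k) = c * Nat.card L := by
    have h1 := sum_extZ (k := k) (L.comap (QuotientGroup.mk' K)) (fun _ => 1) (fun _ => 1)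
    have h2 := sum_extZ (k := k) L (fun _ => 1) (fun _ => 1)
    have h3 := hsum (extZ L (fun _ => 1))
    simp_rw [← hext] at h3
    simp only [one_mul, Finset.sum_const, Finset.card_univ, nsmul_eq_mul, mul_one,
      ← Nat.card_eq_fintype_card] at h1 h2
    rw [← h1, h3, h2]
  rw [indChar_eq, indChar_eq, hcard]
  simp_rw [hext]
  have h4 := hsum (fun q => extZ L θ (q⁻¹ * QuotientGroup.mk g * q))
  have h5 : ∑ x : H, extZ L θ (QuotientGroup.mk (x⁻¹ * g * x)) =
    c * ∑ q, extZ L θ (q⁻¹ * QuotientGroup.mk g * q) := h4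
  rw [h5]
  field_simp

theorem indChar_trans {k : Type} [Field k] [CharZero k] {G : Type} [Group G] [Fintype G]
    (H : Subgroup G) (M : Subgroup H) (θ : M → k) (j : M.map H.subtype → M)
    (hj : ∀ y, ((j y : H) : G) = y) :
    indChar H (indChar M θ) = indChar (M.map H.subtype) (fun y => θ (j y)) := by
  have hH0 : (Nat.card H : k) ≠ 0 := by exact_mod_cast Nat.card_pos.ne'
  set E := extZ (M.map H.subtype) (fun y => θ (j y)) with hE
  have hext : ∀ y : H, extZ M θ y = E y := by
    intro y
    by_cases hy : y ∈ M
    · have hy' : (y : G) ∈ M.map H.subtype := ⟨y, hy, rfl⟩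
      simp only [hE, extZ, hy, hy', dif_pos]
      congr 1
      apply Subtype.ext
      apply Subtype.ext
      exact (hj ⟨y, hy'⟩).symm
    · have hy' : (y : G) ∉ M.map H.subtype := by
        rintro ⟨z, hz, hzy⟩
        exact hy ((Subtype.ext hzy : z = y) ▸ hz)
      simp only [hE, extZ, hy, hy', dif_neg, not_false_eq_true]
  have hext0 : ∀ y : G, y ∉ H → E y = 0 := by
    intro y hy
    have : y ∉ M.map H.subtype := by
      rintro ⟨z, hz, rfl⟩
      exact hy z.2
    simp only [hE, extZ, this, dif_neg, not_false_eq_true]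
  have hcard : Nat.card (M.map H.subtype) = Nat.card M :=
    Nat.card_congr (M.equivMapOfInjective H.subtype H.subtype_injective).symm.toEquiv
  have h1 : ∀ y : G, extZ H (indChar M θ) y = (Nat.card M : k)⁻¹ *
      ∑ h : H, E ((h : G)⁻¹ * y * h) := by
    intro y
    by_cases hy : y ∈ H
    · lift y to H using hy
      rw [extZ_coe, indChar_eq]
      congr 1
      exact Finset.sum_congr rfl fun h _ => hext _
    · rw [Finset.sum_eq_zero]
      · simp [extZ, hy]
      · intro h _
        apply hext0
        intro hm
        apply hy
        have := H.mul_mem (H.mul_mem h.2 hm) (H.inv_mem h.2)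
        simpa [mul_assoc] using this
  ext g
  rw [indChar_eq, indChar_eq, hcard, ← hE]
  simp_rw [h1]
  rw [← Finset.mul_sum, Finset.sum_comm]
  have h2 : ∀ h : H, ∑ x : G, E ((h : G)⁻¹ * (x⁻¹ * g * x) * h) = ∑ x : G, E (x⁻¹ * g * x) := by
    intro h
    refine Fintype.sum_equiv (Equiv.mulRight (h : G)) _ _ fun x => ?_
    simp [mul_assoc]
  simp_rw [h2]
  rw [Finset.sum_const, Finset.card_univ, ← Nat.card_eq_fintype_card, nsmul_eq_mul]
  field_simp

theorem indChar_top {k : Type} [Field k] [CharZero k] {G : Type} [Group G] [Fintype G]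
    (ψ : FDRep k G) : ψ.character = indChar (⊤ : Subgroup G) (fun y => ψ.character (y : G)) := by
  have hG0 : (Nat.card G : k) ≠ 0 := by exact_mod_cast Nat.card_pos.ne'
  ext g
  rw [indChar_eq]
  have : ∀ x : G, extZ (⊤ : Subgroup G) (fun y => ψ.character (y : G)) (x⁻¹ * g * x)
      = ψ.character g := by
    intro x
    have := FDRep.char_conj ψ g x⁻¹
    rw [inv_inv] at this
    rw [← this]
    simp [extZ]
  simp_rw [this]
  rw [Finset.sum_const, Finset.card_univ, ← Nat.card_eq_fintype_card, nsmul_eq_mul,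
    Subgroup.card_top]
  field_simp

end Genotype

namespace Genotype

/-- Every irreducible `𝕂`-linear representation `ψ` of a finite `p`-group `G` is of the
form `ind_{H/K}^G (φ)` for a subquotient `H/K` of `G` which is a Roquette `p`-group and a
faithful irrep `φ` of `H/K` which is not (isomorphic to a representation) induced from any
proper subgroup of `H/K`. -/
theorem irrep_induced_from_roquette_subquotient (p : ℕ) (hp : p.Prime)
    (G : Type) [Group G] [Fintype G] (hG : IsPGroup p G) (k : Type) [Field k] [CharZero k]
    (ψ : FDRep k G) (hψ : IsIrr ψ) :
    ∃ (H : Subgroup G) (K : Subgroup H) (_ : K.Normal),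
      IsRoquette (H ⧸ K) ∧
      ∃ φ : FDRep k (H ⧸ K), IsIrr φ ∧ IsFaithfulRep φ ∧
        ψ.character = indChar H (fun h => φ.character (QuotientGroup.mk h)) ∧
        ∀ L : Subgroup (H ⧸ K), L ≠ ⊤ →
          ∀ θ : FDRep k L, φ.character ≠ indChar L θ.character := by
  have hex : ∃ n, ∃ (H : Subgroup G) (φ : FDRep k H), Nat.card H = n ∧
      ψ.character = indChar H φ.character :=
    ⟨_, ⊤, FDRep.of (ψ.ρ.comp (⊤ : Subgroup G).subtype), rfl, indChar_top ψ⟩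
  obtain ⟨H, φ, hcard, hind⟩ := Nat.find_spec hex
  have hmin : ∀ (H' : Subgroup G) (φ' : FDRep k H'), ψ.character = indChar H' φ'.character →
      Nat.card H ≤ Nat.card H' := by
    intro H' φ' h
    rw [hcard]
    exact Nat.find_min' hex ⟨H', φ', rfl, h⟩
  have hirr := irr_of_induced ψ hψ H φ hind
  let K : Subgroup H := MonoidHom.ker φ.ρ
  have hK : K.Normal := MonoidHom.normal_ker φ.ρ
  let φ' : FDRep k (H ⧸ K) := FDRep.of (QuotientGroup.lift K φ.ρ (fun x hx => hx))
  have hφ'ρ : ∀ h : H, φ'.ρ (QuotientGroup.mk h) = φ.ρ h := fun h => rfl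
  have hφ'c : ∀ h : H, φ'.character (QuotientGroup.mk h) = φ.character h := fun h => rfl
  have hirr' : IsIrr φ' := by
    refine ⟨hirr.1, fun U hU => hirr.2 U fun g x hx => ?_⟩
    exact hU (QuotientGroup.mk g) x hx
  have hfaith : IsFaithfulRep φ' := by
    intro a b hab
    obtain ⟨a, rfl⟩ := QuotientGroup.mk_surjective a
    obtain ⟨b, rfl⟩ := QuotientGroup.mk_surjective b
    have hab' : φ.ρ a = φ.ρ b := hab
    rw [QuotientGroup.eq]
    change φ.ρ (a⁻¹ * b) = 1
    rw [map_mul, ← hab', ← map_mul, inv_mul_cancel, map_one]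
  have hprim : ∀ L : Subgroup (H ⧸ K), L ≠ ⊤ →
      ∀ θ : FDRep k L, φ'.character ≠ indChar L θ.character := by
    intro L hL θ hθ
    let M : Subgroup H := L.comap (QuotientGroup.mk' K)
    let j := (M.equivMapOfInjective H.subtype H.subtype_injective).symm
    let m : M →* L := (QuotientGroup.mk' K).subgroupComap L
    let θ' : FDRep k (M.map H.subtype) := FDRep.of (θ.ρ.comp (m.comp j.toMonoidHom))
    have hj : ∀ y, ((j y : H) : G) = y := by
      intro y
      obtain ⟨z, rfl⟩ := (M.equivMapOfInjective H.subtype H.subtype_injective).surjective y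
      simp only [j, MulEquiv.symm_apply_apply]
      rfl
    have h1 : φ.character = indChar M (fun y => θ.character (m y)) := by
      ext h
      rw [← hφ'c, hθ]
      exact indChar_infl K L θ.character h
    have h2 : ψ.character = indChar (M.map H.subtype) θ'.character := by
      rw [hind, h1]
      exact indChar_trans H M _ j hj
    have h3 := hmin _ θ' h2
    have h4 : Nat.card (M.map H.subtype) = Nat.card M := Nat.card_congr j.toEquiv
    rw [h4] at h3
    have h5 : M = ⊤ := Subgroup.eq_top_of_le_card M h3
    apply hL
    rw [eq_top_iff]
    intro q _
    obtain ⟨h, rfl⟩ := QuotientGroup.mk_surjective q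
    have : h ∈ M := by rw [h5]; trivial
    exact this
  refine ⟨H, K, hK, roquette_of_primitive φ' hirr' hfaith hprim, φ', hirr', hfaith, ?_, hprim⟩
  exact hind

end Genotype
end
end

section
/- Let 𝕃 be a field extension of 𝕂 and let ψ be a 𝕂G-irrep. Then all irreducible 𝕃G-constituents of 𝕃 ⊗_𝕂 ψ occur with one and the same multiplicity: there exist a positive integer m and pairwise non-isomorphic irreducible 𝕃G-representations ψ_1, ..., ψ_v such that 𝕃 ⊗_𝕂 ψ ≅ m(ψ_1 ⊕ ... ⊕ ψ_v). -/
open scoped Classical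

noncomputable section

namespace Genotype
open Module

section chars
variable {k : Type} [Field k] {G : Type} [Group G]

lemma exists_idem_rep {V : Type} [AddCommGroup V] [Module k V] [FiniteDimensional k V]
    (ρ : Representation k G V) (e : V →ₗ[k] V) (he : e * e = e)
    (hc : ∀ g, ρ g * e = e * ρ g) :
    ∃ W : FDRep k G, finrank k W = finrank k (LinearMap.range e) ∧
      ∀ g, W.character g = LinearMap.trace k V (ρ g * e) := by
  have hinv : ∀ g, ∀ x ∈ LinearMap.range e, ρ g x ∈ LinearMap.range e := by
    rintro g _ ⟨y, rfl⟩
    exact ⟨ρ g y, (LinearMap.congr_fun (hc g) y).symm⟩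
  have hfix : ∀ x ∈ LinearMap.range e, e x = x := by
    rintro _ ⟨y, rfl⟩
    exact LinearMap.congr_fun he y
  let σ : Representation k G (LinearMap.range e) :=
    { toFun := fun g => (ρ g).restrict (hinv g)
      map_one' := by ext x; simp
      map_mul' := by intro a b; ext x; simp }
  refine ⟨FDRep.of σ, rfl, fun g => ?_⟩
  have h2 : ∀ x, (ρ g * e) x ∈ LinearMap.range e := fun x => hinv g _ ⟨x, rfl⟩
  rw [← LinearMap.trace_restrict_eq_of_forall_mem (LinearMap.range e) (ρ g * e) h2]
  change LinearMap.trace k (LinearMap.range e) ((ρ g).restrict (hinv g)) = _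
  congr 1
  ext x
  simp [hfix x.1 x.2]

variable [Fintype G] [CharZero k]

lemma exists_equivariant_proj {V : Type} [AddCommGroup V] [Module k V]
    (ρ : Representation k G V) (U : Submodule k V) (hU : ∀ g, ∀ x ∈ U, ρ g x ∈ U) :
    ∃ e : V →ₗ[k] V, (∀ x, e x ∈ U) ∧ (∀ x ∈ U, e x = x) ∧ ∀ g, ρ g * e = e * ρ g := by
  obtain ⟨π, hπ⟩ := U.exists_isCompl
  obtain ⟨f, hf⟩ := LinearMap.exists_leftInverse_of_injective U.subtype (by simp)
  let p : V →ₗ[k] V := U.subtype ∘ₗ f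
  have hp1 : ∀ x, p x ∈ U := fun x => (f x).2
  have hp2 : ∀ x ∈ U, p x = x := fun x hx => by
    have := LinearMap.congr_fun hf ⟨x, hx⟩
    simp only [LinearMap.comp_apply, Submodule.subtype_apply, LinearMap.id_apply] at this
    simp [p, this]
  have hn : (Fintype.card G : k) ≠ 0 := by exact_mod_cast Fintype.card_ne_zero
  refine ⟨(Fintype.card G : k)⁻¹ • ∑ g : G, ρ g * p * ρ g⁻¹, fun x => ?_, fun x hx => ?_, fun h => ?_⟩
  · simp only [LinearMap.smul_apply, LinearMap.sum_apply]
    exact U.smul_mem _ (U.sum_mem fun g _ => hU _ _ (hp1 _))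
  · simp only [LinearMap.smul_apply, LinearMap.sum_apply]
    have : ∀ g : G, (ρ g * p * ρ g⁻¹) x = x := fun g => by
      simp [hp2 _ (hU g⁻¹ x hx)]
    simp [this, ← Nat.cast_smul_eq_nsmul k, smul_smul, hn]
  · simp only [mul_smul_comm, smul_mul_assoc, Finset.mul_sum, Finset.sum_mul]
    congr 1
    refine Fintype.sum_equiv (Equiv.mulLeft h) _ _ fun g => ?_
    simp only [Equiv.coe_mulLeft, mul_inv_rev, map_mul, mul_assoc]
    rw [← map_mul ρ h⁻¹ h]
    simp

/-- set of irreducible characters -/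
def IrrS (k G : Type) [Field k] [Group G] : Set (G → k) := {f | IsIrrChar f}

lemma char_mem_closure (n : ℕ) : ∀ V : FDRep k G, finrank k V ≤ n →
    V.character ∈ AddSubmonoid.closure (IrrS k G) := by
  induction n with
  | zero =>
    intro V hV
    have : V.character = 0 := by
      ext g
      have : Subsingleton V := finrank_zero_iff.1 (Nat.le_zero.1 hV)
      have h0 : V.ρ g = 0 := Subsingleton.elim _ _
      simp [FDRep.character, h0]
    rw [this]; exact zero_mem _
  | succ n ih =>
    intro V hV
    by_cases hi : IsIrr V
    · exact AddSubmonoid.subset_closure ⟨V, hi, rfl⟩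
    rcases subsingleton_or_nontrivial V with hs | hs
    · exact ih V (by rw [finrank_zero_of_subsingleton]; exact Nat.zero_le _)
    simp only [IsIrr, hs, true_and, not_forall, not_or] at hi
    obtain ⟨U, hU, hb, ht⟩ := hi
    obtain ⟨e, he1, he2, he3⟩ := exists_equivariant_proj V.ρ U hU
    have hr : LinearMap.range e = U := le_antisymm (by rintro _ ⟨x, rfl⟩; exact he1 x)
      (fun x hx => ⟨x, he2 x hx⟩)
    have hee : e * e = e := by ext x; exact he2 _ (he1 x)
    obtain ⟨W1, hd1, hc1⟩ := exists_idem_rep V.ρ e hee he3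
    obtain ⟨W2, hd2, hc2⟩ := exists_idem_rep V.ρ (1 - e)
      (by simp [mul_sub, sub_mul, hee]) (fun g => by simp [mul_sub, sub_mul, he3])
    have hk : finrank k (LinearMap.range (1 - e)) ≤ finrank k (LinearMap.ker e) := by
      apply Submodule.finrank_mono
      rintro _ ⟨x, rfl⟩
      have := LinearMap.congr_fun hee x
      simp only [Module.End.mul_apply] at this
      simp [this]
    have hs1 := LinearMap.finrank_range_add_finrank_ker e
    have hlt : finrank k (LinearMap.range e) < finrank k V := by
      rw [hr]; exact Submodule.finrank_lt ht
    have hpos : 0 < finrank k (LinearMap.range e) := by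
      rw [hr]; exact Nat.pos_of_ne_zero (fun h => hb (Submodule.finrank_eq_zero.1 h))
    have : V.character = W1.character + W2.character := by
      ext g
      simp only [Pi.add_apply, hc1, hc2, ← map_add, ← mul_add]
      simp [FDRep.character]
    rw [this]
    exact add_mem (ih W1 (by omega)) (ih W2 (by omega))

/-- inner product of class functions -/
def ip (f h : G → k) : k := (Nat.card G : k)⁻¹ * ∑ g : G, f g * h g⁻¹

lemma ip_comm (f h : G → k) : ip f h = ip h f := by
  unfold ip
  congr 1
  exact Fintype.sum_equiv (Equiv.inv G) _ _ fun g => by simp [mul_comm]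

lemma ip_add_left (f f' h : G → k) : ip (f + f') h = ip f h + ip f' h := by
  simp [ip, add_mul, Finset.sum_add_distrib, mul_add]

lemma ip_smul_left (c : k) (f h : G → k) : ip (c • f) h = c * ip f h := by
  simp only [ip, Pi.smul_apply, smul_eq_mul, mul_assoc, ← Finset.mul_sum]
  ring

lemma ip_char (V W : FDRep k G) :
    ip W.character V.character = finrank k (Representation.IntertwiningMap V.ρ W.ρ) := by
  have : (Nat.card G : k) ≠ 0 := by exact_mod_cast Nat.card_pos.ne'
  have : Invertible (Nat.card G : k) := invertibleOfNonzero this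
  exact Representation.card_inv_mul_sum_char_mul_char_eq_finrank V.ρ W.ρ

instance intertwining_finite (V W : FDRep k G) :
    Module.Finite k (Representation.IntertwiningMap V.ρ W.ρ) := by
  let F : Representation.IntertwiningMap V.ρ W.ρ →ₗ[k] (V →ₗ[k] W) :=
    { toFun := fun f => f.toLinearMap, map_add' := fun _ _ => rfl, map_smul' := fun _ _ => rfl }
  refine Module.Finite.of_injective F ?_
  intro a b h
  cases a; cases b; congr

/-- Schur -/
lemma schur {V W : FDRep k G} (hV : IsIrr V) (hW : IsIrr W) (f : V →ₗ[k] W)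
    (hf : ∀ g x, f (V.ρ g x) = W.ρ g (f x)) (h0 : f ≠ 0) : Function.Bijective f := by
  constructor
  · rw [← LinearMap.ker_eq_bot]
    rcases hV.2 (LinearMap.ker f) (fun g x hx => by
      rw [LinearMap.mem_ker] at hx ⊢; rw [hf, hx, map_zero]) with h | h
    · exact h
    · exact absurd (LinearMap.ker_eq_top.1 h) h0
  · rw [← LinearMap.range_eq_top]
    rcases hW.2 (LinearMap.range f) (by rintro g _ ⟨x, rfl⟩; exact ⟨V.ρ g x, hf g x⟩) with h | h
    · exact absurd (LinearMap.range_eq_bot.1 h) h0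
    · exact h

lemma char_eq_of_bij {V W : FDRep k G} (f : V →ₗ[k] W)
    (hf : ∀ g x, f (V.ρ g x) = W.ρ g (f x)) (hb : Function.Bijective f) :
    V.character = W.character := by
  ext g
  let e := LinearEquiv.ofBijective f hb
  have : W.ρ g = e.conj (V.ρ g) := by
    ext y
    obtain ⟨x, rfl⟩ := e.surjective y
    simp only [LinearEquiv.conj_apply_apply, LinearEquiv.symm_apply_apply]
    exact (hf g x).symm
  simp only [FDRep.character, this, LinearMap.trace_conj']

lemma hom_zero_of_ne {V W : FDRep k G} (hV : IsIrr V) (hW : IsIrr W)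
    (hne : V.character ≠ W.character) (f : V →ₗ[k] W)
    (hf : ∀ g x, f (V.ρ g x) = W.ρ g (f x)) : f = 0 := by
  by_contra h0
  exact hne (char_eq_of_bij f hf (schur hV hW f hf h0))

lemma ip_irr_ne {f h : G → k} (hf : IsIrrChar f) (hh : IsIrrChar h) (hne : f ≠ h) : ip f h = 0 := by
  obtain ⟨V, hV, rfl⟩ := hf
  obtain ⟨W, hW, rfl⟩ := hh
  rw [ip_char]
  have : Subsingleton (Representation.IntertwiningMap W.ρ V.ρ) := by
    constructor
    have key : ∀ a : Representation.IntertwiningMap W.ρ V.ρ, a.toLinearMap = 0 := fun a =>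
      hom_zero_of_ne hW hV (Ne.symm hne) a.toLinearMap
        (fun g x => LinearMap.congr_fun (a.isIntertwining' g) x)
    intro a b
    have h1 := key a
    have h2 := key b
    cases a; cases b; congr 1; exact h1.trans h2.symm
  rw [finrank_zero_of_subsingleton, Nat.cast_zero]

lemma ip_irr_self {f : G → k} (hf : IsIrrChar f) : ∃ n : ℕ, 0 < n ∧ ip f f = n := by
  obtain ⟨V, hV, rfl⟩ := hf
  refine ⟨_, ?_, ip_char V V⟩
  have : Nontrivial (Representation.IntertwiningMap V.ρ V.ρ) := by
    have := hV.1
    refine ⟨⟨⟨LinearMap.id, fun g => rfl⟩, 0, fun h => ?_⟩⟩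
    obtain ⟨x, hx⟩ := exists_ne (0 : V)
    have := congrArg (fun a => a.toLinearMap x) h
    exact hx this
  exact finrank_pos

end chars
end Genotype

namespace Genotype
open Module

section adams
variable {k : Type} [Field k]
set_option linter.unusedSectionVars false

lemma path_sum {ι : Type} [Fintype ι] [DecidableEq ι] (A : Matrix ι ι k) (n : ℕ) : ∀ a b : ι,
    (A ^ n) a b = ∑ x : Fin (n + 1) → ι, if x 0 = a ∧ x (Fin.last n) = b then
      ∏ i : Fin n, A (x i.castSucc) (x i.succ) else 0 := by
  induction n with
  | zero =>
    intro a b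
    rw [← (Equiv.funUnique (Fin 1) ι).symm.sum_comp]
    simp only [pow_zero, Matrix.one_apply, Finset.univ_eq_empty, Finset.prod_empty]
    by_cases h : a = b
    · subst h; simp [Equiv.funUnique]
    · rw [if_neg h]; symm; apply Finset.sum_eq_zero; intro x _; rw [if_neg]
      rintro ⟨h1, h2⟩; exact h (h1.symm.trans h2)
  | succ n ih =>
    intro a b
    rw [pow_succ', Matrix.mul_apply, ← (Fin.consEquiv (fun _ => ι)).sum_comp, Fintype.sum_prod_type]
    simp only [Fin.consEquiv, Equiv.coe_fn_mk, Fin.cons_zero]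
    symm
    rw [Finset.sum_eq_single a]
    · simp only [ih, Finset.mul_sum]
      rw [Finset.sum_comm]
      refine Finset.sum_congr rfl fun y _ => ?_
      rw [Finset.sum_eq_single (y 0)]
      · simp only [true_and, ← Fin.succ_last, Fin.cons_succ, Fin.prod_univ_succ, Fin.castSucc_zero,
          Fin.cons_zero, ← Fin.succ_castSucc, mul_ite, mul_zero]
      · intro c _ hc; rw [if_neg]; · simp
        rintro ⟨h, -⟩; exact hc h.symm
      · simp
    · intro c _ hc; apply Finset.sum_eq_zero; intro y _; rw [if_neg]
      rintro ⟨h, -⟩; exact hc h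
    · simp

lemma trace_cycle {ι : Type} [Fintype ι] [DecidableEq ι] (A : Matrix ι ι k) (n : ℕ) :
    ∑ x : Fin (n + 1) → ι, ∏ i, A (x i) (x (i + 1)) = Matrix.trace (A ^ (n + 1)) := by
  rw [pow_succ]
  simp only [Matrix.trace, Matrix.diag, Matrix.mul_apply, path_sum, Finset.sum_mul]
  have : ∀ a : ι, ∑ c : ι, ∑ x : Fin (n + 1) → ι, (if x 0 = a ∧ x (Fin.last n) = c then
      ∏ i : Fin n, A (x i.castSucc) (x i.succ) else 0) * A c a =
      ∑ x : Fin (n + 1) → ι, if x 0 = a then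
      (∏ i : Fin n, A (x i.castSucc) (x i.succ)) * A (x (Fin.last n)) (x 0) else 0 := by
    intro a
    rw [Finset.sum_comm]
    refine Finset.sum_congr rfl fun x _ => ?_
    rw [Finset.sum_eq_single (x (Fin.last n))]
    · by_cases h : x 0 = a <;> simp [h]
    · intro c _ hc; rw [if_neg]; · simp
      rintro ⟨-, h⟩; exact hc h.symm
    · simp
  simp only [this]
  rw [Finset.sum_comm]
  refine Finset.sum_congr rfl fun x _ => ?_
  rw [Finset.sum_ite_eq, if_pos (Finset.mem_univ _), Fin.prod_univ_castSucc]
  simp [Fin.last_add_one]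

/-- operator of matrix power and permutation -/
def Mq {ι Z : Type} [Fintype ι] [Fintype Z] (A : Matrix ι ι k) (w : Equiv.Perm Z) :
    Matrix (Z → ι) (Z → ι) k := Matrix.of fun x y => ∏ i, A (x i) (y (w i))

variable {ι Z : Type} [Fintype ι] [DecidableEq ι] [Fintype Z]

lemma Mq_mul (A B : Matrix ι ι k) (w u : Equiv.Perm Z) : Mq A w * Mq B u = Mq (A * B) (u * w) := by
  ext x z
  simp only [Mq, Matrix.mul_apply, Matrix.of_apply, Equiv.Perm.mul_apply]
  rw [Finset.prod_univ_sum, ← (Equiv.arrowCongr w (Equiv.refl ι)).sum_comp]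
  simp only [Fintype.piFinset_univ]
  refine Finset.sum_congr rfl fun y _ => ?_
  rw [Finset.prod_mul_distrib, ← Equiv.prod_comp w (fun i => B ((Equiv.arrowCongr w (Equiv.refl ι)) y i) (z (u i)))]
  simp [Equiv.arrowCongr]

lemma Mq_one : Mq (1 : Matrix ι ι k) (1 : Equiv.Perm Z) = 1 := by
  ext x y
  simp only [Mq, Matrix.of_apply, Matrix.one_apply, Equiv.Perm.coe_one, id]
  by_cases h : x = y
  · subst h; simp
  · rw [if_neg h]
    obtain ⟨i, hi⟩ := Function.ne_iff.1 h
    exact Finset.prod_eq_zero (Finset.mem_univ i) (if_neg hi)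

/-- trace -/
def Tq (A : Matrix ι ι k) (w : Equiv.Perm Z) : k := Matrix.trace (Mq A w)

lemma Tq_conj (A : Matrix ι ι k) (w u : Equiv.Perm Z) : Tq A (u * w * u⁻¹) = Tq A w := by
  have h1 : Mq A (u * w * u⁻¹) = Mq 1 u⁻¹ * (Mq A w * Mq 1 u) := by
    rw [Mq_mul, Mq_mul]; simp
  unfold Tq
  rw [h1, Matrix.trace_mul_comm, mul_assoc, Mq_mul, Mq_mul]
  simp

lemma avg_char {G : Type} [Group G] [Fintype G] [CharZero k] (A : G →* Matrix ι ι k) (I : Type) [Fintype I] [Nonempty I]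
    (w : I → Equiv.Perm Z) (h : ∀ i, ∃ e : I ≃ I, ∀ j, w (e j) = w j * w i) :
    ∃ V : FDRep k G, ∀ g, V.character g = (Fintype.card I : k)⁻¹ * ∑ i, Tq (A g) (w i) := by
  have hn : (Fintype.card I : k) ≠ 0 := by exact_mod_cast Fintype.card_ne_zero
  let ρ : Representation k G ((Z → ι) → k) :=
    { toFun := fun g => Matrix.toLinAlgEquiv' (Mq (A g) 1)
      map_one' := by rw [map_one, Mq_one, map_one]
      map_mul' := fun a b => by rw [← map_mul Matrix.toLinAlgEquiv', Mq_mul, map_mul, mul_one] }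
  let E : Matrix (Z → ι) (Z → ι) k := (Fintype.card I : k)⁻¹ • ∑ i, Mq 1 (w i)
  have hE : E * E = E := by
    simp only [E, smul_mul_assoc, mul_smul_comm, Finset.sum_mul]
    have : ∀ i, Mq (1 : Matrix ι ι k) (w i) * ∑ j, Mq 1 (w j) = ∑ j, Mq 1 (w j) := by
      intro i
      obtain ⟨e, he⟩ := h i
      rw [Finset.mul_sum, ← e.sum_comp (fun j => Mq 1 (w j))]
      refine Finset.sum_congr rfl fun j _ => ?_
      rw [Mq_mul, he, mul_one]
    simp only [this, Finset.sum_const, Finset.card_univ, ← Nat.cast_smul_eq_nsmul k, smul_smul]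
    rw [inv_mul_cancel₀ hn, mul_one]
  have hc : ∀ g, Mq (A g) 1 * E = E * Mq (A g) 1 := by
    intro g
    simp only [E, smul_mul_assoc, mul_smul_comm, Finset.sum_mul, Finset.mul_sum, Mq_mul, mul_one, one_mul]
  obtain ⟨W, -, hW⟩ := exists_idem_rep ρ (Matrix.toLinAlgEquiv' E)
    (by rw [← map_mul, hE])
    (fun g => by
      change Matrix.toLinAlgEquiv' (Mq (A g) 1) * _ = _ * Matrix.toLinAlgEquiv' (Mq (A g) 1)
      rw [← map_mul, ← map_mul, hc])
  refine ⟨W, fun g => ?_⟩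
  rw [hW]
  change LinearMap.trace k _ (Matrix.toLinAlgEquiv' (Mq (A g) 1) * _) = _
  rw [← map_mul]
  change LinearMap.trace k _ (Matrix.toLin' (Mq (A g) 1 * E)) = _
  rw [Matrix.trace_toLin'_eq]
  simp only [E, mul_smul_comm, Finset.mul_sum, Mq_mul, mul_one, Matrix.trace_smul, Matrix.trace_sum,
    smul_eq_mul, Tq]

/-- affine perm -/
def aff {q : ℕ} (u : (ZMod q)ˣ) (b : ZMod q) : Equiv.Perm (ZMod q) :=
  (Units.mulLeft u).trans (Equiv.addRight b)

lemma aff_apply {q : ℕ} (u : (ZMod q)ˣ) (b i : ZMod q) : aff u b i = u * i + b := rfl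

lemma aff_mul {q : ℕ} (u v : (ZMod q)ˣ) (b c : ZMod q) : aff u b * aff v c = aff (u * v) (u * c + b) := by
  ext i
  simp only [Equiv.Perm.mul_apply, aff_apply, Units.val_mul]
  ring

lemma Tq_aff_ne {q : ℕ} [Fact q.Prime] (A : Matrix ι ι k) (u : (ZMod q)ˣ) (hu : u ≠ 1) (b : ZMod q) :
    Tq A (aff u b) = Tq A (aff u 0) := by
  have h1 : (1 - (u : ZMod q)) ≠ 0 := by
    intro h; apply hu; ext; rw [Units.val_one]; exact (sub_eq_zero.1 h).symm
  rw [← Tq_conj A (aff u 0) (aff 1 (b / (1 - u)))]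
  congr 1
  rw [eq_mul_inv_iff_mul_eq, aff_mul, aff_mul]
  simp only [mul_one, one_mul, Units.val_one]
  congr 1
  field_simp
  ring

lemma Tq_shift_ne {q : ℕ} [Fact q.Prime] (A : Matrix ι ι k) (b : ZMod q) (hb : b ≠ 0) :
    Tq A (aff 1 b) = Tq A (aff 1 (1 : ZMod q)) := by
  rw [← Tq_conj A (aff 1 1) (aff (Units.mk0 b hb) 0)]
  congr 1
  rw [eq_mul_inv_iff_mul_eq, aff_mul, aff_mul]
  simp

lemma Tq_shift {q : ℕ} [Fact q.Prime] (A : Matrix ι ι k) :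
    Tq A (aff 1 (1 : ZMod q)) = Matrix.trace (A ^ q) := by
  obtain ⟨n, rfl⟩ := Nat.exists_eq_succ_of_ne_zero (Fact.out : q.Prime).ne_zero
  refine Eq.trans ?_ (trace_cycle A n)
  simp only [Tq, Matrix.trace, Matrix.diag, Mq, Matrix.of_apply, aff_apply, Units.val_one, one_mul]
  let e := ZMod.finEquiv (n + 1)
  have key : ∑ y : ZMod (n + 1) → ι, ∏ i, A (y i) (y (i + 1)) =
      ∑ x : Fin (n + 1) → ι, ∏ i, A (x i) (x (i + 1)) := by
    refine (Equiv.sum_comp (Equiv.arrowCongr e.toEquiv (Equiv.refl ι))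
      (fun y : ZMod (n + 1) → ι => ∏ i, A (y i) (y (i + 1)))).symm.trans ?_
    refine Finset.sum_congr rfl fun x _ => ?_
    refine (Equiv.prod_comp e.toEquiv (fun i : ZMod (n + 1) =>
      A (Equiv.arrowCongr e.toEquiv (Equiv.refl ι) x i)
        (Equiv.arrowCongr e.toEquiv (Equiv.refl ι) x (i + 1)))).symm.trans ?_
    refine Finset.prod_congr rfl fun i _ => ?_
    have h1 : e.symm (e i + 1) = i + 1 := by rw [map_add, map_one, e.symm_apply_apply]
    have h2 : e.symm (e i) = i := e.symm_apply_apply i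
    change A (x (e.symm (e i))) (x (e.symm (e i + 1))) = A (x i) (x (i + 1))
    rw [h1, h2]
  convert key

/-- virtual characters -/
def VR (k G : Type) [Field k] [Group G] : AddSubgroup (G → k) :=
  AddSubgroup.closure {f | ∃ V : FDRep k G, f = V.character}

/-- Adams operation -/
def adams {k G : Type} [Group G] (t : ℕ) (f : G → k) : G → k := fun g => f (g ^ t)

variable {G : Type} [Group G] [Fintype G] [CharZero k]

lemma char_mem_VR (V : FDRep k G) : V.character ∈ VR k G := AddSubgroup.subset_closure ⟨V, rfl⟩

lemma adams_prime_char (q : ℕ) (hq : q.Prime) (V : FDRep k G) :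
    adams q V.character ∈ VR k G := by
  have : Fact q.Prime := ⟨hq⟩
  let b := Module.finBasis k V
  let A : G →* Matrix (Fin (finrank k V)) (Fin (finrank k V)) k :=
    (LinearMap.toMatrixAlgEquiv b : _ →* _).comp V.ρ
  have hA : ∀ g, V.character g = Matrix.trace (A g) := fun g =>
    LinearMap.trace_eq_matrix_trace k b (V.ρ g)
  obtain ⟨V1, h1⟩ := avg_char A Unit (fun _ => (1 : Equiv.Perm (ZMod q)))
    (fun _ => ⟨Equiv.refl _, fun _ => rfl⟩)
  obtain ⟨V2, h2⟩ := avg_char A (ZMod q)ˣ (fun u => aff u (0 : ZMod q))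
    (fun v => ⟨Equiv.mulRight v, fun u => by simp [aff_mul]⟩)
  obtain ⟨V3, h3⟩ := avg_char A ((ZMod q)ˣ × ZMod q) (fun u => aff u.1 u.2)
    (fun v => by
      refine ⟨Equiv.ofBijective (fun u : (ZMod q)ˣ × ZMod q => (u.1 * v.1, u.1 * v.2 + u.2))
        (Finite.injective_iff_bijective.1 ?_), fun u => by simp [aff_mul]⟩
      rintro ⟨u, b⟩ ⟨u', b'⟩ h
      simp only [Prod.mk.injEq, mul_left_inj] at h
      obtain ⟨rfl, h⟩ := h
      simpa using h)
  have key : adams q V.character = V1.character - q • V2.character + q • V3.character := by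
    ext g
    have hq1 : ((Fintype.card (ZMod q)ˣ : ℕ) : k) = q - 1 := by
      rw [ZMod.card_units, Nat.cast_sub hq.one_le, Nat.cast_one]
    have hne : (q : k) - 1 ≠ 0 := by
      rw [sub_ne_zero]; exact_mod_cast hq.one_lt.ne'
    have hq0 : (q : k) ≠ 0 := by exact_mod_cast hq.ne_zero
    have e0 : adams q V.character g = Tq (A g) (aff 1 (1 : ZMod q)) := by
      rw [Tq_shift, adams, hA, map_pow]
    have haff1 : (aff 1 0 : Equiv.Perm (ZMod q)) = 1 := by ext i; simp [aff_apply]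
    set S := ∑ u ∈ Finset.univ.erase (1 : (ZMod q)ˣ), Tq (A g) (aff u (0 : ZMod q)) with hS
    have e2 : ∑ u : (ZMod q)ˣ, Tq (A g) (aff u (0 : ZMod q)) = Tq (A g) (1 : Equiv.Perm (ZMod q)) + S := by
      rw [hS, ← haff1]
      exact (Finset.add_sum_erase _ (fun u => Tq (A g) (aff u (0 : ZMod q))) (Finset.mem_univ _)).symm
    have e3 : ∑ u : (ZMod q)ˣ × ZMod q, Tq (A g) (aff u.1 u.2) =
        Tq (A g) (1 : Equiv.Perm (ZMod q)) + (q - 1) * Tq (A g) (aff 1 (1 : ZMod q)) + q * S := by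
      rw [Fintype.sum_prod_type, ← Finset.add_sum_erase _ _ (Finset.mem_univ (1 : (ZMod q)ˣ)),
        ← Finset.add_sum_erase _ _ (Finset.mem_univ (0 : ZMod q)), hS, Finset.mul_sum]
      congr 1
      · rw [haff1]
        congr 1
        rw [Finset.sum_congr rfl (fun b hb => Tq_shift_ne (A g) b (Finset.ne_of_mem_erase hb))]
        rw [Finset.sum_const, Finset.card_erase_of_mem (Finset.mem_univ _), Finset.card_univ,
          ZMod.card, nsmul_eq_mul, Nat.cast_sub hq.one_le, Nat.cast_one]
      · refine Finset.sum_congr rfl fun u hu => ?_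
        simp only [Tq_aff_ne (A g) u (Finset.ne_of_mem_erase hu)]
        rw [Finset.sum_const, Finset.card_univ, ZMod.card, nsmul_eq_mul]
    simp only [Pi.add_apply, Pi.sub_apply, Pi.smul_apply]
    simp only [nsmul_eq_mul]
    rw [e0, h1, h2, h3, e2, e3, Fintype.card_prod, Nat.cast_mul, hq1, ZMod.card]
    simp only [Finset.univ_unique, Finset.sum_const, Finset.card_singleton, Fintype.card_unit,
      Nat.cast_one, inv_one, one_smul]
    field_simp
    ring
  rw [key]
  exact add_mem (sub_mem (char_mem_VR _) (nsmul_mem (char_mem_VR _) _)) (nsmul_mem (char_mem_VR _) _)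

lemma adams_add (t : ℕ) (f h : G → k) : adams t (f + h) = adams t f + adams t h := rfl
lemma adams_neg (t : ℕ) (f : G → k) : adams t (-f) = -adams t f := rfl
lemma adams_adams (t s : ℕ) (f : G → k) : adams t (adams s f) = adams (t * s) f := by
  ext g; simp [adams, pow_mul]

lemma adams_prime_mem (q : ℕ) (hq : q.Prime) (f : G → k) (hf : f ∈ VR k G) : adams q f ∈ VR k G := by
  induction hf using AddSubgroup.closure_induction with
  | mem x hx => obtain ⟨V, rfl⟩ := hx; exact adams_prime_char q hq V
  | zero => exact zero_mem _
  | add x y _ _ h1 h2 => exact add_mem h1 h2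
  | neg x _ h => exact neg_mem h

lemma adams_mem (t : ℕ) (ht : t ≠ 0) : ∀ f ∈ VR k G, adams t f ∈ VR k G := by
  induction t using Nat.recOnMul with
  | zero => exact absurd rfl ht
  | one => intro f hf; convert hf using 1; ext g; simp [adams]
  | prime q hq => exact adams_prime_mem q hq
  | mul a b ha hb =>
    intro f hf
    rw [← adams_adams]
    exact ha (left_ne_zero_of_mul ht) _ (hb (right_ne_zero_of_mul ht) f hf)

end adams
end Genotype

namespace Genotype
open Module

section lattice
variable {k : Type} [Field k] {G : Type} [Group G] [Fintype G] [CharZero k]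
set_option linter.unusedSectionVars false

lemma ip_sum_left {J : Type} (s : Finset J) (F : J → G → k) (h : G → k) :
    ip (∑ i ∈ s, F i) h = ∑ i ∈ s, ip (F i) h := by
  induction s using Finset.induction_on with
  | empty => simp [ip]
  | insert a s ha ih => rw [Finset.sum_insert ha, Finset.sum_insert ha, ip_add_left, ih]

/-- the norm -/
def nrm (i : IrrS k G) : ℕ := (ip_irr_self i.2).choose
lemma nrm_pos (i : IrrS k G) : 0 < nrm i := (ip_irr_self i.2).choose_spec.1
lemma ip_self (i : IrrS k G) : ip i.1 i.1 = (nrm i : k) := (ip_irr_self i.2).choose_spec.2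
lemma nrm_ne (i : IrrS k G) : (nrm i : k) ≠ 0 := by exact_mod_cast (nrm_pos i).ne'

lemma ip_lin (s : Finset (IrrS k G)) (a : IrrS k G → k) (j : IrrS k G) :
    ip (∑ i ∈ s, a i • i.1) j.1 = if j ∈ s then a j * nrm j else 0 := by
  rw [ip_sum_left]
  simp only [ip_smul_left]
  split_ifs with h
  · rw [Finset.sum_eq_single j]
    · rw [ip_self]
    · intro b _ hb; rw [ip_irr_ne b.2 j.2 (fun h => hb (Subtype.ext h)), mul_zero]
    · intro h'; exact absurd h h'
  · apply Finset.sum_eq_zero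
    intro b hb; rw [ip_irr_ne b.2 j.2 (fun h' => h (Subtype.ext h' ▸ hb)), mul_zero]

lemma irr_li : LinearIndependent k (fun i : IrrS k G => i.1) := by
  rw [linearIndependent_iff']
  intro s a h j hj
  have := ip_lin s a j
  rw [h, if_pos hj] at this
  have h0 : ip (0 : G → k) j.1 = 0 := by simp [ip]
  rw [h0] at this
  exact (mul_eq_zero.1 this.symm).resolve_right (nrm_ne j)

instance irr_fintype : Fintype (IrrS k G) :=
  @Fintype.ofFinite _ (irr_li (k := k) (G := G)).finite

lemma exists_nat_coeff (f : G → k) (hf : f ∈ AddSubmonoid.closure (IrrS k G)) :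
    ∃ a : IrrS k G → ℕ, f = ∑ i, (a i : k) • i.1 := by
  induction hf using AddSubmonoid.closure_induction with
  | mem x hx =>
    refine ⟨fun i => if i = ⟨x, hx⟩ then 1 else 0, ?_⟩
    rw [Finset.sum_eq_single ⟨x, hx⟩]
    · simp
    · intro b _ hb; simp [hb]
    · simp
  | zero => exact ⟨0, by simp⟩
  | add x y _ _ h1 h2 =>
    obtain ⟨a, rfl⟩ := h1
    obtain ⟨b, rfl⟩ := h2
    exact ⟨a + b, by simp [add_smul, Finset.sum_add_distrib]⟩

lemma exists_int_coeff (f : G → k) (hf : f ∈ VR k G) :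
    ∃ a : IrrS k G → ℤ, f = ∑ i, (a i : k) • i.1 := by
  induction hf using AddSubgroup.closure_induction with
  | mem x hx =>
    obtain ⟨V, rfl⟩ := hx
    obtain ⟨a, ha⟩ := exists_nat_coeff _ (char_mem_closure _ V le_rfl)
    exact ⟨fun i => a i, by simpa using ha⟩
  | zero => exact ⟨0, by simp⟩
  | add x y _ _ h1 h2 =>
    obtain ⟨a, rfl⟩ := h1
    obtain ⟨b, rfl⟩ := h2
    exact ⟨a + b, by simp [add_smul, Finset.sum_add_distrib]⟩
  | neg x _ h1 =>
    obtain ⟨a, rfl⟩ := h1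
    exact ⟨-a, by simp⟩

lemma irr_mem_VR (i : IrrS k G) : i.1 ∈ VR k G := by
  obtain ⟨V, -, h⟩ := i.2
  rw [h]; exact char_mem_VR V

lemma irr_one (i : IrrS k G) : ∃ n : ℕ, 0 < n ∧ i.1 1 = n := by
  obtain ⟨V, hV, h⟩ := i.2
  have := hV.1
  exact ⟨finrank k V, finrank_pos, by rw [h, FDRep.char_one]⟩

lemma irr_ne_zero (i : IrrS k G) : i.1 ≠ 0 := by
  intro h
  obtain ⟨n, hn, h1⟩ := irr_one i
  rw [h] at h1
  rw [Pi.zero_apply] at h1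
  exact hn.ne' (by exact_mod_cast h1.symm)

lemma ip_adams (t : ℕ) (ht : (Nat.card G).Coprime t) (f h : G → k) :
    ip (adams t f) (adams t h) = ip f h := by
  unfold ip
  congr 1
  refine Fintype.sum_equiv (powCoprime ht) _ _ fun g => ?_
  simp [adams, inv_pow]

lemma pow_modEq (g : G) {a b : ℕ} (h : a ≡ b [MOD Nat.card G]) : g ^ a = g ^ b :=
  pow_eq_pow_iff_modEq.2 (h.of_dvd (orderOf_dvd_natCard g))

lemma exists_inv (t : ℕ) (ht0 : t ≠ 0) (ht : (Nat.card G).Coprime t) : ∃ t' : ℕ, t' ≠ 0 ∧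
    (Nat.card G).Coprime t' ∧ (∀ f : G → k, adams t' (adams t f) = f) ∧
    (∀ f : G → k, adams t (adams t' f) = f) := by
  have hφ : 0 < (Nat.card G).totient := Nat.totient_pos.2 Nat.card_pos
  have h1 : t * t ^ ((Nat.card G).totient - 1) ≡ 1 [MOD Nat.card G] := by
    rw [← pow_succ', Nat.sub_add_cancel hφ]
    exact Nat.ModEq.pow_totient ht.symm
  refine ⟨t ^ ((Nat.card G).totient - 1), pow_ne_zero _ ht0, ht.pow_right _, fun f => ?_, fun f => ?_⟩
  · rw [adams_adams, mul_comm]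
    ext g
    rw [adams, pow_modEq g h1, pow_one]
  · rw [adams_adams]
    ext g
    rw [adams, pow_modEq g h1, pow_one]

lemma adams_irr (t : ℕ) (ht0 : t ≠ 0) (ht : (Nat.card G).Coprime t) (φ : IrrS k G) :
    adams t φ.1 ∈ IrrS k G := by
  obtain ⟨t', ht'0, ht', hl, hr⟩ := exists_inv (k := k) t ht0 ht
  obtain ⟨a, ha⟩ := exists_int_coeff _ (adams_mem t ht0 _ (irr_mem_VR φ))
  have hf0 : adams t φ.1 ≠ 0 := by
    intro h
    have := hl φ.1
    rw [h] at this
    exact irr_ne_zero φ this.symm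
  obtain ⟨j, hj⟩ : ∃ j, a j ≠ 0 := by
    by_contra hcon
    push Not at hcon
    apply hf0
    rw [ha]
    simp [hcon]
  have hip : ip (adams t φ.1) j.1 = a j * nrm j := by
    rw [ha, ip_lin, if_pos (Finset.mem_univ _)]
  obtain ⟨b, hb⟩ := exists_int_coeff _ (adams_mem t' ht'0 _ (irr_mem_VR j))
  -- b φ * nrm φ = a j * nrm j
  have e1 : b φ * nrm φ = a j * nrm j := by
    have : ip (adams t' j.1) φ.1 = b φ * nrm φ := by
      rw [hb, ip_lin, if_pos (Finset.mem_univ _)]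
    rw [← ip_adams t ht, hr, ip_comm, hip] at this
    exact_mod_cast this.symm
  have e2 : ∑ i, b i * b i * nrm i = nrm j := by
    have : ip (adams t' j.1) (adams t' j.1) = ∑ i, (b i * b i * nrm i : k) := by
      conv_lhs => rw [hb, ip_sum_left, ← hb]
      refine Finset.sum_congr rfl fun i _ => ?_
      rw [ip_smul_left, ip_comm, hb, ip_lin, if_pos (Finset.mem_univ _), mul_assoc]
    rw [ip_adams t' ht', ip_self] at this
    exact_mod_cast this.symm
  have hnn : ∀ i, 0 ≤ b i * b i * (nrm i : ℤ) := fun i =>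
    mul_nonneg (mul_self_nonneg _) (by positivity)
  have e3 := Finset.add_sum_erase Finset.univ (fun i => b i * b i * (nrm i : ℤ)) (Finset.mem_univ φ)
  simp only [e2] at e3
  have hnj : (0 : ℤ) < nrm j := by exact_mod_cast nrm_pos j
  have hnφ : (0 : ℤ) < nrm φ := by exact_mod_cast nrm_pos φ
  have hge : 0 ≤ ∑ i ∈ Finset.univ.erase φ, b i * b i * (nrm i : ℤ) :=
    Finset.sum_nonneg fun i _ => hnn i
  have hbφ : b φ ≠ 0 := by
    intro h
    rw [h, zero_mul] at e1
    rcases mul_eq_zero.1 e1.symm with h | h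
    · exact hj h
    · exact hnj.ne' h
  -- n_j ≤ |a j| n_j = |b φ| n_φ ≤ b φ ^2 n_φ ≤ n_j
  have habs : |b φ| * nrm φ = |a j| * nrm j := by
    have := congrArg abs e1
    rwa [abs_mul, abs_mul, abs_of_pos hnj, abs_of_pos hnφ] at this
  have haj : 1 ≤ |a j| := Int.one_le_abs hj
  have hbj : 1 ≤ |b φ| := Int.one_le_abs hbφ
  have hsq : b φ * b φ = |b φ| * |b φ| := (abs_mul_abs_self _).symm
  have hb1 : |b φ| = 1 := by
    rw [hsq] at e3
    by_contra hne
    have h2 : 2 ≤ |b φ| := by omega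
    nlinarith [mul_le_mul_of_nonneg_right haj hnj.le, mul_pos (show 0 < |b φ| by omega) hnφ]
  have hrest : ∑ i ∈ Finset.univ.erase φ, b i * b i * (nrm i : ℤ) = 0 := by
    rw [hsq, hb1] at e3
    rw [hb1] at habs
    nlinarith [mul_le_mul_of_nonneg_right haj hnj.le]
  have hz : ∀ i, i ≠ φ → b i = 0 := by
    intro i hi
    have := (Finset.sum_eq_zero_iff_of_nonneg (fun i _ => hnn i)).1 hrest i
      (Finset.mem_erase.2 ⟨hi, Finset.mem_univ _⟩)
    rcases mul_eq_zero.1 this with h | h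
    · exact mul_self_eq_zero.1 h
    · exact absurd (by exact_mod_cast h) (nrm_pos i).ne'
  have hx : adams t' j.1 = (b φ : k) • φ.1 := by
    rw [hb, Finset.sum_eq_single φ]
    · intro i _ hi; rw [hz i hi]; simp
    · simp
  have hx2 : j.1 = (b φ : k) • adams t φ.1 := by
    rw [← hr j.1, hx]; rfl
  obtain ⟨n1, hn1, h1⟩ := irr_one φ
  obtain ⟨n2, hn2, h2⟩ := irr_one j
  have hone : b φ = 1 := by
    rcases (abs_eq (zero_le_one)).1 hb1 with h | h
    · exact h
    · exfalso
      have := congrFun hx2 1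
      rw [h2] at this
      simp only [Pi.smul_apply, adams, one_pow, h1, h, smul_eq_mul] at this
      have : (n2 : ℤ) = (-1) * n1 := by exact_mod_cast this
      omega
  rw [hone] at hx2
  simp only [Int.cast_one, one_smul] at hx2
  rw [← hx2]; exact j.2

lemma conv_zero {V W : FDRep k G} (hV : IsIrr V) (hW : IsIrr W)
    (hne : V.character ≠ W.character) : ∑ g : G, V.character g⁻¹ • W.ρ g = 0 := by
  ext w
  let b := Module.finBasis k V
  have hX : ∀ i v, ∑ g : G, b.coord i (V.ρ g⁻¹ v) • W.ρ g w = 0 := by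
    intro i v
    let X : V →ₗ[k] W := ∑ g : G, ((b.coord i) ∘ₗ V.ρ g⁻¹).smulRight (W.ρ g w)
    have hXa : ∀ v, X v = ∑ g : G, b.coord i (V.ρ g⁻¹ v) • W.ρ g w := fun v => by
      simp [X, LinearMap.sum_apply]
    have : X = 0 := by
      apply hom_zero_of_ne hV hW hne
      intro h x
      rw [hXa, hXa, map_sum]
      refine Fintype.sum_equiv (Equiv.mulLeft h⁻¹) _ _ fun g => ?_
      simp only [Equiv.coe_mulLeft, map_smul, ← Module.End.mul_apply, ← map_mul]
      simp
    rw [← hXa, this]; rfl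
  have htr : ∀ g, V.character g = ∑ i, b.coord i (V.ρ g (b i)) := by
    intro g
    rw [FDRep.character, LinearMap.trace_eq_matrix_trace k b]
    simp [Matrix.trace, LinearMap.toMatrix_apply]
  simp only [LinearMap.sum_apply, LinearMap.smul_apply, htr, Finset.sum_smul, LinearMap.zero_apply]
  rw [Finset.sum_comm]
  exact Finset.sum_eq_zero fun i _ => hX i _

end lattice
end Genotype

namespace Genotype
open Module

lemma idem_trace {Ω ι : Type} [Field Ω] [Fintype ι] [DecidableEq ι] (e : Matrix ι ι Ω) (he : e * e = e) :
    ∃ n : ℕ, Matrix.trace e = n := by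
  have h : IsIdempotentElem (Matrix.toLin' e) := by
    change Matrix.toLinAlgEquiv' e * Matrix.toLinAlgEquiv' e = Matrix.toLinAlgEquiv' e
    rw [← map_mul, he]
  have hp : LinearMap.IsProj (LinearMap.range (Matrix.toLin' e)) (Matrix.toLin' e) :=
    LinearMap.isProj_range_iff_isIdempotentElem _ |>.2 h
  exact ⟨_, by rw [← Matrix.trace_toLin'_eq]; exact hp.trace⟩

lemma matrix_fourier {Ω ι : Type} [Field Ω] [CharZero Ω] [Fintype ι] [DecidableEq ι] (N : ℕ) (hN : 0 < N)
    (ζ : Ω) (hζ : IsPrimitiveRoot ζ N) (B : Matrix ι ι Ω) (hB : B ^ N = 1) :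
    ∃ d : ℕ → ℕ, ∀ t : ℕ, Matrix.trace (B ^ t) = ∑ k ∈ Finset.range N, (d k : Ω) * ζ ^ (k * t) := by
  have hN0 : (N : Ω) ≠ 0 := by exact_mod_cast hN.ne'
  have hz0 : ζ ≠ 0 := hζ.ne_zero hN.ne'
  let e : ℕ → Matrix ι ι Ω := fun k => (N : Ω)⁻¹ • ∑ j ∈ Finset.range N, (ζ⁻¹ ^ (k * j)) • B ^ j
  have hBe : ∀ k, B * e k = ζ ^ k • e k := by
    intro k
    simp only [e, mul_smul_comm, Finset.mul_sum]
    rw [smul_comm (ζ ^ k)]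
    congr 1
    let F : ℕ → Matrix ι ι Ω := fun j => (ζ ^ k * ζ⁻¹ ^ (k * j)) • B ^ j
    have h1 : ∀ j, ζ⁻¹ ^ (k * j) • (B * B ^ j) = F (j + 1) := by
      intro j
      simp only [F]
      have hs : ζ ^ k * ζ⁻¹ ^ (k * (j + 1)) = ζ⁻¹ ^ (k * j) := by
        rw [mul_add, mul_one, pow_add, mul_comm (ζ⁻¹ ^ (k * j)), ← mul_assoc, ← mul_pow,
          mul_inv_cancel₀ hz0, one_pow, one_mul]
      rw [hs, ← pow_succ']
    have h2 : F N = F 0 := by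
      simp only [F, hB, pow_zero, mul_zero]
      rw [mul_comm k N, pow_mul, inv_pow, hζ.pow_eq_one]; simp
    have h3 : ∑ j ∈ Finset.range N, F (j + 1) = ∑ j ∈ Finset.range N, F j := by
      have a := Finset.sum_range_succ F N
      have b := Finset.sum_range_succ' F N
      rw [h2] at a
      exact add_right_cancel (b.symm.trans a)
    rw [Finset.sum_congr rfl (fun j _ => h1 j), h3, Finset.smul_sum]
    refine Finset.sum_congr rfl fun j _ => ?_
    simp only [F, smul_smul]
  have hBje : ∀ j k, B ^ j * e k = ζ ^ (k * j) • e k := by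
    intro j k
    induction j with
    | zero => simp
    | succ j ih => rw [pow_succ, mul_assoc, hBe, mul_smul_comm, ih, smul_smul, mul_add, mul_one, pow_add, mul_comm]
  have hee : ∀ k, e k * e k = e k := by
    intro k
    conv_lhs => enter [1]; simp only [e]
    rw [smul_mul_assoc, Finset.sum_mul]
    simp only [smul_mul_assoc, hBje, smul_smul, ← mul_pow, inv_mul_cancel₀ hz0, one_pow, one_smul,
      Finset.sum_const, Finset.card_range, ← Nat.cast_smul_eq_nsmul Ω, inv_mul_cancel₀ hN0]
  have hsum : ∑ k ∈ Finset.range N, e k = 1 := by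
    simp only [e]
    rw [← Finset.smul_sum, Finset.sum_comm, Finset.sum_eq_single 0]
    · simp [← Nat.cast_smul_eq_nsmul Ω, smul_smul, hN0]
    · intro j hj hj0
      rw [← Finset.sum_smul]
      have hne : ζ⁻¹ ^ j ≠ 1 := by
        rw [inv_pow]
        intro h
        rw [inv_eq_one] at h
        have := hζ.dvd_of_pow_eq_one _ h
        exact absurd (Nat.le_of_dvd (Nat.pos_of_ne_zero hj0) this) (not_le.2 (Finset.mem_range.1 hj))
      have : ∑ i ∈ Finset.range N, ζ⁻¹ ^ (i * j) = 0 := by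
        have h1 : ∀ i, ζ⁻¹ ^ (i * j) = (ζ⁻¹ ^ j) ^ i := fun i => by rw [mul_comm, pow_mul]
        simp only [h1]
        rw [geom_sum_eq hne, ← pow_mul, mul_comm, pow_mul, inv_pow, hζ.pow_eq_one]
        simp
      rw [this, zero_smul]
    · intro h; exact absurd (Finset.mem_range.2 hN) h
  choose d hd using fun k => idem_trace (e k) (hee k)
  refine ⟨d, fun t => ?_⟩
  rw [← mul_one (B ^ t), ← hsum, Finset.mul_sum, Matrix.trace_sum]
  refine Finset.sum_congr rfl fun k _ => ?_
  rw [hBje, Matrix.trace_smul, hd, smul_eq_mul, mul_comm]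

section gal
variable {L : Type} [Field L] [CharZero L] {G : Type} [Group G] [Fintype G]

lemma char_fourier {Ω : Type} [Field Ω] [Algebra L Ω] (ζ : Ω) (hζ : IsPrimitiveRoot ζ (Nat.card G))
    (f : G → L) (hf : f ∈ VR L G) (g : G) :
    ∃ d : ℕ → ℤ, ∀ t : ℕ, algebraMap L Ω (f (g ^ t)) =
      ∑ k ∈ Finset.range (Nat.card G), (d k : Ω) * ζ ^ (k * t) := by
  have : CharZero Ω := charZero_of_injective_algebraMap (algebraMap L Ω).injective
  induction hf using AddSubgroup.closure_induction with
  | mem x hx =>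
    obtain ⟨V, rfl⟩ := hx
    let b := Module.finBasis L V
    let A := (LinearMap.toMatrixAlgEquiv b) (V.ρ g)
    have hA : A ^ Nat.card G = 1 := by
      simp only [A]
      rw [← map_pow, ← map_pow, pow_card_eq_one', map_one, map_one]
    obtain ⟨d, hd⟩ := matrix_fourier (Nat.card G) Nat.card_pos ζ hζ ((algebraMap L Ω).mapMatrix A)
      (by rw [← map_pow, hA, map_one])
    refine ⟨fun k => d k, fun t => ?_⟩
    simp only [Int.cast_natCast]
    rw [← hd t, ← map_pow]
    have : V.character (g ^ t) = Matrix.trace (A ^ t) := by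
      simp only [A]
      rw [← map_pow, ← map_pow]
      exact LinearMap.trace_eq_matrix_trace L b (V.ρ (g ^ t))
    rw [this]
    simp [Matrix.trace]
  | zero => exact ⟨0, by simp⟩
  | add x y _ _ h1 h2 =>
    obtain ⟨a, ha⟩ := h1
    obtain ⟨b, hb⟩ := h2
    exact ⟨a + b, fun t => by simp [ha, hb, add_mul, Finset.sum_add_distrib]⟩
  | neg x _ h1 =>
    obtain ⟨a, ha⟩ := h1
    exact ⟨-a, fun t => by simp [ha]⟩

lemma exists_T_aux (K : Type) [Field K] [CharZero K] [Algebra K L] (E Ω : Type) [Field E] [Field Ω]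
    [Algebra K E] [Algebra L Ω] [Algebra K Ω] [IsScalarTower K L Ω] [IsGalois K E]
    [FiniteDimensional K E] (i : E →ₐ[K] Ω) (N : ℕ) (hN : N = Nat.card G) (z : E)
    (hz : IsPrimitiveRoot z N) :
    ∃ T : ℕ → Prop, (∀ t, T t → t ≠ 0 ∧ (Nat.card G).Coprime t) ∧ T 1 ∧
      (∀ s t, T s → T t → T (s * t)) ∧
      (∀ f ∈ VR L G, (∀ g, ∃ c : K, algebraMap K L c = f g) ↔ ∀ t, T t → adams t f = f) := by
  have hNpos : 0 < N := hN ▸ Nat.card_pos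
  subst hN
  set N := Nat.card G with hNdef
  have hinj : Function.Injective i := i.injective
  have hζ : IsPrimitiveRoot (i z) N := hz.map_of_injective hinj
  refine ⟨fun t => t ≠ 0 ∧ N.Coprime t ∧ ∃ σ : E ≃ₐ[K] E, σ z = z ^ t, fun t h => ⟨h.1, h.2.1⟩,
    ⟨one_ne_zero, Nat.coprime_one_right _, AlgEquiv.refl, by simp⟩, ?_, ?_⟩
  · rintro s t ⟨hs0, hs, σ, hσ⟩ ⟨ht0, ht, τ, hτ⟩
    refine ⟨mul_ne_zero hs0 ht0, hs.mul_right ht, σ.trans τ, ?_⟩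
    rw [AlgEquiv.trans_apply, hσ, map_pow, hτ, ← pow_mul, mul_comm]
  · intro f hf
    have key : ∀ g : G, ∃ x : E, i x = algebraMap L Ω (f g) ∧ ∀ (σ : E ≃ₐ[K] E) (t : ℕ), σ z = z ^ t →
        i (σ x) = algebraMap L Ω (f (g ^ t)) := by
      intro g
      obtain ⟨d, hd⟩ := char_fourier (i z) hζ f hf g
      refine ⟨∑ k ∈ Finset.range N, (d k : E) * z ^ k, ?_, fun σ t h => ?_⟩
      · have := hd 1
        rw [pow_one] at this
        rw [this]
        simp [hNdef]
      · rw [hd t]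
        simp [h, hNdef, ← pow_mul, mul_comm]
    constructor
    · rintro h t ⟨-, -, σ, hσ⟩
      ext g
      obtain ⟨x, hx, hx2⟩ := key g
      obtain ⟨c, hc⟩ := h g
      have hxc : x = algebraMap K E c := by
        apply hinj
        rw [hx, ← hc, AlgHom.commutes, ← IsScalarTower.algebraMap_apply K L Ω]
      have := hx2 σ t hσ
      rw [hxc, AlgEquiv.commutes, ← hxc, hx] at this
      exact ((algebraMap L Ω).injective this).symm
    · intro h g
      obtain ⟨x, hx, hx2⟩ := key g
      have hfix : ∀ σ : E ≃ₐ[K] E, σ x = x := by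
        intro σ
        have hσz : IsPrimitiveRoot (σ z) N := hz.map_of_injective σ.injective
        obtain ⟨t, -, ht, hzt⟩ := (hz.isPrimitiveRoot_iff).1 hσz
        have hσ : σ z = z ^ (t + N) := by rw [pow_add, hz.pow_eq_one, mul_one, hzt]
        have hcop : N.Coprime (t + N) := by simpa using ht.symm
        apply hinj
        rw [hx2 σ _ hσ, hx]
        congr 1
        exact congrFun (h (t + N) ⟨by omega, hcop, σ, hσ⟩) g
      have : x ∈ (⊥ : IntermediateField K E) := (IsGalois.mem_bot_iff_fixed x).2 hfix
      obtain ⟨c, hc⟩ := IntermediateField.mem_bot.1 this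
      refine ⟨c, (algebraMap L Ω).injective ?_⟩
      rw [← hx, ← hc, AlgHom.commutes, ← IsScalarTower.algebraMap_apply K L Ω]

/-- There is a multiplicatively closed set of exponents detecting K-rationality. -/
lemma exists_T (K : Type) [Field K] [CharZero K] [Algebra K L] :
    ∃ T : ℕ → Prop, (∀ t, T t → t ≠ 0 ∧ (Nat.card G).Coprime t) ∧ T 1 ∧
      (∀ s t, T s → T t → T (s * t)) ∧
      (∀ f ∈ VR L G, (∀ g, ∃ c : K, algebraMap K L c = f g) ↔ ∀ t, T t → adams t f = f) := by
  let N := Nat.card G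
  have hNpos : 0 < N := Nat.card_pos
  haveI : NeZero N := ⟨hNpos.ne'⟩
  let E := CyclotomicField N K
  let Ω := AlgebraicClosure L
  have : IsGalois K E := IsCyclotomicExtension.isGalois {N} K E
  have : FiniteDimensional K E := IsCyclotomicExtension.finiteDimensional {N} K E
  exact exists_T_aux K E Ω (IsAlgClosed.lift : E →ₐ[K] Ω) N rfl (IsCyclotomicExtension.zeta N K E)
    (IsCyclotomicExtension.zeta_spec N K E)

end gal
end Genotype

namespace Genotype
open Module
open scoped TensorProduct

section fin
variable {G : Type} [Group G] [Fintype G]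

def bcRep {K : Type} (L : Type) [Field K] [Field L] [Algebra K L] (ψ : FDRep K G) :
    Representation L G (L ⊗[K] ψ) where
  toFun g := (ψ.ρ g).baseChange L
  map_one' := by
    rw [map_one]; exact LinearMap.baseChange_id
  map_mul' a b := by
    rw [map_mul]; exact LinearMap.baseChange_comp _ _

lemma bc_char {K : Type} (L : Type) [Field K] [Field L] [Algebra K L] (ψ : FDRep K G) :
    (FDRep.of (bcRep L ψ)).character = fun g => algebraMap K L (ψ.character g) := by
  ext g
  exact LinearMap.trace_baseChange (ψ.ρ g) L

variable {L : Type} [Field L] [CharZero L]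

lemma adams_sum (t : ℕ) {J : Type} (s : Finset J) (F : J → G → L) :
    adams t (∑ i ∈ s, F i) = ∑ i ∈ s, adams t (F i) := by
  ext g; simp [adams, Finset.sum_apply]

lemma orbit_stable (O : Finset (IrrS L G)) (t : ℕ) (ht0 : t ≠ 0) (ht : (Nat.card G).Coprime t)
    (h : ∀ i ∈ O, ∀ j : IrrS L G, j.1 = adams t i.1 → j ∈ O) :
    adams t (∑ i ∈ O, i.1) = ∑ i ∈ O, i.1 := by
  rw [adams_sum]
  let e : IrrS L G → IrrS L G := fun i => ⟨adams t i.1, adams_irr t ht0 ht i⟩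
  have hm : Set.MapsTo e O O := fun i hi => h i hi (e i) rfl
  have hi : Set.InjOn e O := by
    intro a _ b _ hab
    obtain ⟨t', -, -, h1, -⟩ := exists_inv (k := L) t ht0 ht
    have : adams t a.1 = adams t b.1 := congrArg Subtype.val hab
    apply Subtype.ext
    rw [← h1 a.1, this, h1]
  exact Finset.sum_nbij e hm hi (Finset.surjOn_of_injOn_of_card_le e hm hi le_rfl) fun i _ => rfl

lemma class_mem {f : G → L} (hf : f ∈ VR L G) (g h : G) : f (h * g * h⁻¹) = f g := by
  induction hf using AddSubgroup.closure_induction with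
  | mem x hx => obtain ⟨V, rfl⟩ := hx; exact FDRep.char_conj V g h
  | zero => rfl
  | add x y _ _ h1 h2 => simp [h1, h2]
  | neg x _ h1 => simp [h1]

lemma sum_conv_zero (O : Finset (IrrS L G)) (W : FDRep L G) (hW : IsIrr W)
    (h : ∀ j ∈ O, j.1 ≠ W.character) : ∑ g, (∑ i ∈ O, i.1) g⁻¹ • W.ρ g = 0 := by
  simp only [Finset.sum_apply, Finset.sum_smul]
  rw [Finset.sum_comm]
  refine Finset.sum_eq_zero fun j hj => ?_
  obtain ⟨V, hV, hVj⟩ := j.2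
  rw [hVj]
  exact conv_zero hV hW (hVj ▸ h j hj)

lemma main_aux {K : Type} [Field K] [CharZero K] [Algebra K L] (ψ : FDRep K G) (hψ : IsIrr ψ)
    (O : Finset (IrrS L G)) (s : G → K) (hs : ∀ g, algebraMap K L (s g) = (∑ i ∈ O, i.1) g)
    (hip : ip (fun g => algebraMap K L (ψ.character g)) (∑ i ∈ O, i.1) ≠ 0)
    (i : IrrS L G) (hi : i ∉ O) : ip (fun g => algebraMap K L (ψ.character g)) i.1 = 0 := by
  have hSVR : (∑ i ∈ O, i.1) ∈ VR L G := sum_mem fun i _ => irr_mem_VR i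
  have hscl : ∀ g h, s (h * g * h⁻¹) = s g := by
    intro g h
    apply (algebraMap K L).injective
    rw [hs, hs, class_mem hSVR]
  let z : ψ →ₗ[K] ψ := ∑ g, s g⁻¹ • ψ.ρ g
  have hz : ∀ h x, z (ψ.ρ h x) = ψ.ρ h (z x) := by
    intro h x
    simp only [z, LinearMap.sum_apply, LinearMap.smul_apply, map_sum, map_smul]
    refine Fintype.sum_equiv (MulAut.conj h⁻¹).toEquiv _ _ fun g => ?_
    simp only [MulEquiv.toEquiv_eq_coe, EquivLike.coe_coe, MulAut.conj_apply, inv_inv]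
    rw [← Module.End.mul_apply, ← Module.End.mul_apply, ← map_mul, ← map_mul]
    congr 1
    · rw [← hscl g⁻¹ h⁻¹]; congr 1; group
    · congr 2; group
  have hz0 : z ≠ 0 := by
    intro h0
    apply hip
    have h1 : algebraMap K L (LinearMap.trace K ψ z) = 0 := by rw [h0]; simp
    simp only [z, map_sum, map_smul, smul_eq_mul, map_mul, hs] at h1
    unfold ip
    have h2 : ∑ g : G, algebraMap K L (ψ.character g) * (∑ i ∈ O, i.1) g⁻¹ = 0 := by
      rw [← h1]
      exact Finset.sum_congr rfl fun g _ => mul_comm _ _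
    rw [h2, mul_zero]
  have hb := schur hψ hψ z hz hz0
  obtain ⟨W, hW, hWi⟩ := i.2
  rw [hWi, ← bc_char, ip_char]
  have hsub : Subsingleton (Representation.IntertwiningMap W.ρ (FDRep.of (bcRep L ψ)).ρ) := by
    refine ⟨fun a b => ?_⟩
    have hall : ∀ f : Representation.IntertwiningMap W.ρ (FDRep.of (bcRep L ψ)).ρ, ∀ x, f x = 0 := by
      intro f x
      have hzero := sum_conv_zero O W hW (fun j hj h => hi (by
        have : j = i := Subtype.ext (h.trans hWi.symm)
        exact this ▸ hj))
      have hinj : Function.Injective (z.baseChange L) := by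
        exact Module.Flat.lTensor_preserves_injective_linearMap (M := L) z hb.1
      apply hinj
      rw [map_zero]
      have h1 : z.baseChange L = ∑ g, (∑ i ∈ O, i.1) g⁻¹ • bcRep L ψ g := by
        ext y
        simp [z, bcRep, TensorProduct.tmul_sum, ← hs, LinearMap.sum_apply, TensorProduct.smul_tmul']
      have h2 : ∀ g, bcRep L ψ g (f x) = f (W.ρ g x) := by
        intro g
        exact (Representation.IntertwiningMap.isIntertwining _ _ f g x).symm
      have h3 : f ((∑ g, (∑ i ∈ O, i.1) g⁻¹ • W.ρ g) x) = z.baseChange L (f x) := by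
        rw [h1]
        simp only [LinearMap.sum_apply, LinearMap.smul_apply, h2, map_sum, map_smul]
      exact h3.symm.trans (by rw [hzero]; exact f.toLinearMap.map_zero)
    ext x
    exact (hall a x).trans (hall b x).symm
  rw [Module.finrank_zero_of_subsingleton, Nat.cast_zero]

theorem final {K : Type} [Field K] [CharZero K] [Algebra K L] (ψ : FDRep K G) (hψ : IsIrr ψ) :
    ∃ (m : ℕ) (O : Finset (IrrS L G)), 0 < m ∧ 0 < O.card ∧
      (fun g => algebraMap K L (ψ.character g)) = m • ∑ i ∈ O, i.1 := by
  set c : G → L := fun g => algebraMap K L (ψ.character g) with hc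
  have hcb : c = (FDRep.of (bcRep L ψ)).character := (bc_char L ψ).symm
  have hcVR : c ∈ VR L G := hcb ▸ char_mem_VR _
  obtain ⟨a, ha⟩ := exists_nat_coeff c (hcb ▸ char_mem_closure _ _ le_rfl)
  have hipc : ∀ j : IrrS L G, ip c j.1 = a j * nrm j := by
    intro j
    have := ip_lin Finset.univ (fun i => (a i : L)) j
    rw [← ha, if_pos (Finset.mem_univ _)] at this
    exact this
  obtain ⟨φ, hφ⟩ : ∃ φ, a φ ≠ 0 := by
    by_contra! h
    have h1 : c 1 = 0 := by rw [ha]; simp [h]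
    have := hψ.1
    have h2 : c 1 = (finrank K ψ : L) := by rw [hc]; simp [FDRep.char_one]
    have h3 : (0 : ℕ) < finrank K ψ := finrank_pos
    rw [h2] at h1
    exact h3.ne' (by exact_mod_cast h1)
  obtain ⟨T, hT, hT1, hTm, hTi⟩ := exists_T (L := L) (G := G) K
  let O : Finset (IrrS L G) := Finset.univ.filter fun i => ∃ t, T t ∧ i.1 = adams t φ.1
  have hφO : φ ∈ O := by
    simp only [O, Finset.mem_filter, Finset.mem_univ, true_and]
    exact ⟨1, hT1, by ext g; simp [adams]⟩
  have hSt : ∀ t, T t → adams t (∑ i ∈ O, i.1) = ∑ i ∈ O, i.1 := by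
    intro t ht
    refine orbit_stable O t (hT t ht).1 (hT t ht).2 ?_
    intro i hi j hj
    simp only [O, Finset.mem_filter, Finset.mem_univ, true_and] at hi ⊢
    obtain ⟨r, hr, hir⟩ := hi
    exact ⟨t * r, hTm _ _ ht hr, by rw [hj, hir, adams_adams]⟩
  have hSVR : (∑ i ∈ O, i.1) ∈ VR L G := sum_mem fun i _ => irr_mem_VR i
  choose s hs using (hTi _ hSVR).2 hSt
  have hct := (hTi c hcVR).1 fun g => ⟨_, rfl⟩
  have haO : ∀ i ∈ O, a i = a φ := by
    intro i hi
    simp only [O, Finset.mem_filter, Finset.mem_univ, true_and] at hi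
    obtain ⟨t, ht, hit⟩ := hi
    have h1 : ip c i.1 = ip c φ.1 := by
      rw [hit]; nth_rewrite 1 [← hct t ht]; exact ip_adams t (hT t ht).2 _ _
    have h2 : (nrm i : L) = nrm φ := by
      rw [← ip_self, ← ip_self, hit, ip_adams t (hT t ht).2]
    rw [hipc, hipc, h2] at h1
    exact_mod_cast mul_right_cancel₀ (nrm_ne φ) h1
  have hip : ip c (∑ i ∈ O, i.1) ≠ 0 := by
    rw [ip_comm, ip_sum_left]
    have h1 : ∀ i ∈ O, ip i.1 c = ((a i * nrm i : ℕ) : L) := by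
      intro i _
      rw [ip_comm, hipc]; push_cast; rfl
    rw [Finset.sum_congr rfl h1, ← Nat.cast_sum]
    have : 0 < ∑ i ∈ O, a i * nrm i :=
      Finset.sum_pos' (fun _ _ => Nat.zero_le _)
        ⟨φ, hφO, Nat.mul_pos (Nat.pos_of_ne_zero hφ) (nrm_pos φ)⟩
    exact_mod_cast this.ne'
  have hout : ∀ i ∉ O, a i = 0 := by
    intro i hi
    have := main_aux ψ hψ O s hs hip i hi
    rw [hipc] at this
    exact_mod_cast (mul_eq_zero.1 this).resolve_right (nrm_ne i)
  refine ⟨a φ, O, Nat.pos_of_ne_zero hφ, Finset.card_pos.2 ⟨φ, hφO⟩, ?_⟩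
  rw [ha, ← Finset.sum_subset (Finset.subset_univ O) (fun i _ hi => by rw [hout i hi]; simp),
    Finset.smul_sum]
  refine Finset.sum_congr rfl fun i hi => ?_
  rw [haO i hi, Nat.cast_smul_eq_nsmul]

end fin
end Genotype


namespace Genotype

/-- Let `𝕃/𝕂` be a field extension and `ψ` an irreducible `𝕂G`-representation. Then all
irreducible `𝕃G`-constituents of `𝕃 ⊗_𝕂 ψ` occur with one and the same multiplicity:
there are `m > 0` and pairwise non-isomorphic irreducible `𝕃G`-representations
`ψ_1, ..., ψ_v` with `𝕃 ⊗_𝕂 ψ ≅ m (ψ_1 ⊕ ... ⊕ ψ_v)` (an isomorphism of representations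
in characteristic zero being equivalent to an equality of characters, and the character
of `𝕃 ⊗_𝕂 ψ` being the composite of the character of `ψ` with `algebraMap 𝕂 𝕃`). -/
theorem scalar_extension_isotypic (p : ℕ) (hp : p.Prime)
    (G : Type) [Group G] [Fintype G] (hG : IsPGroup p G)
    (K L : Type) [Field K] [CharZero K] [Field L] [Algebra K L]
    (ψ : FDRep K G) (hψ : IsIrr ψ) :
    ∃ (m v : ℕ), 0 < m ∧ 0 < v ∧
      ∃ ψs : Fin v → FDRep L G,
        (∀ i, IsIrr (ψs i)) ∧
        (∀ i j, i ≠ j → (ψs i).character ≠ (ψs j).character) ∧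
        (fun g => algebraMap K L (ψ.character g)) = m • ∑ i, (ψs i).character := by
  have : CharZero L := charZero_of_injective_algebraMap (algebraMap K L).injective
  obtain ⟨m, O, hm, hO, h⟩ := final (L := L) ψ hψ
  choose V hV hVc using fun i : IrrS L G => i.2
  let e := O.equivFin.symm
  refine ⟨m, O.card, hm, hO, fun i => V (e i).1, fun i => hV _, fun i j hij heq => hij ?_, ?_⟩
  · rw [← hVc, ← hVc] at heq
    exact e.injective (Subtype.ext (Subtype.ext heq))
  · rw [h]
    congr 1
    rw [← Finset.sum_coe_sort, ← e.sum_comp]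
    exact Finset.sum_congr rfl fun i _ => hVc _

end Genotype
end
end

section
/- Let G be a finite p-group. Then every normal abelian subgroup of G is cyclic if and only if G is isomorphic to one of the following groups: the cyclic group C_{p^m} of order p^m with m ≥ 0; the generalized quaternion group Q_{2^m} with m ≥ 3; the dihedral group D_{2^m} with m ≥ 4; or the semidihedral group SD_{2^m} with m ≥ 4. -/
open scoped Classical

noncomputable section

namespace Genotype

/-- The relators `a^{2^{m-1}} = d^2 = 1`, `d a d⁻¹ = a^{2^{m-2}-1}` for the semidihedral
group of order `2^m`, on the two generators `a = of 0`, `d = of 1`. -/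
def sdRels (m : ℕ) : Set (FreeGroup (Fin 2)) :=
  {FreeGroup.of 0 ^ 2 ^ (m - 1), FreeGroup.of 1 ^ 2,
    FreeGroup.of 1 * FreeGroup.of 0 * (FreeGroup.of 1)⁻¹ *
      (FreeGroup.of 0 ^ (2 ^ (m - 2) - 1))⁻¹}

/-- The semidihedral group of order `2^m`, given by its standard presentation
`⟨a, d : a^{2^{m-1}} = d^2 = 1, d a d⁻¹ = a^{2^{m-2}-1}⟩`. -/
abbrev SemidihedralGroup (m : ℕ) : Type := PresentedGroup (sdRels m)

theorem aux_conj_zpow {G : Type} [Group G] {g a : G} {u : ℤ} (h : g * a * g⁻¹ = a ^ u) (i : ℤ) :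
    g * a ^ i * g⁻¹ = a ^ (u * i) := by
  rw [← conj_zpow, h, zpow_mul]

theorem aux_conj_pow {G : Type} [Group G] {g a : G} {u : ℤ} (h : g * a * g⁻¹ = a ^ u) (i : ℕ) :
    g ^ i * a * (g ^ i)⁻¹ = a ^ (u ^ i) := by
  induction i with
  | zero => simp
  | succ t ih =>
    have : g ^ (t+1) * a * (g ^ (t+1))⁻¹ = g * (g ^ t * a * (g^t)⁻¹) * g⁻¹ := by
      rw [pow_succ']; group
    rw [this, ih, aux_conj_zpow h, pow_succ']

theorem aux_mul_pow {G : Type} [Group G] {w a : G} {u : ℤ} (h : w * a * w⁻¹ = a ^ u) (j : ℤ) (t : ℕ) :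
    (a ^ j * w) ^ t = a ^ (j * ∑ i ∈ Finset.range t, u ^ i) * w ^ t := by
  induction t with
  | zero => simp
  | succ t ih =>
    rw [pow_succ', ih, geom_sum_succ, pow_succ']
    have h2 := aux_conj_zpow h (j * ∑ i ∈ Finset.range t, u ^ i)
    have h3 : w * a ^ (j * ∑ i ∈ Finset.range t, u ^ i) =
      a ^ (u * (j * ∑ i ∈ Finset.range t, u ^ i)) * w := by rw [← h2]; group
    rw [mul_assoc, ← mul_assoc w, h3, mul_assoc, ← mul_assoc, ← zpow_add]
    congr 2
    ring

theorem aux_sum (p : ℕ) (hp : p.Prime) (u : ℤ) (h1 : (p : ℤ) ∣ u - 1) (h2 : p = 2 → (4:ℤ) ∣ u - 1) :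
    ∃ s : ℤ, ∑ i ∈ Finset.range p, u ^ i = p * s ∧ IsCoprime s (p : ℤ) := by
  rcases hp.eq_two_or_odd' with rfl | ho
  · obtain ⟨t, ht⟩ := h2 rfl
    refine ⟨1 + 2 * t, ?_, ⟨1, -t, by push_cast; ring⟩⟩
    have : u = 1 + 4 * t := by linarith
    subst this
    simp [Finset.sum_range_succ]; ring
  · obtain ⟨b, hb⟩ := h1
    have := odd_sq_dvd_geom_sum₂_sub (R := ℤ) (a := 1) (b := b) ho
    have hu : u = 1 + p * b := by linarith
    simp only [one_pow, mul_one, ← hu] at this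
    obtain ⟨t, ht⟩ := this
    exact ⟨1 + p * t, by linear_combination ht, ⟨1, -t, by ring⟩⟩

theorem aux_closure_normal {G : Type} [Group G] (S : Set G)
    (h : ∀ g : G, ∀ s ∈ S, g * s * g⁻¹ ∈ Subgroup.closure S) : (Subgroup.closure S).Normal := by
  constructor
  intro n hn g
  have : Subgroup.closure S ≤ (Subgroup.closure S).comap (MulAut.conj g).toMonoidHom := by
    rw [Subgroup.closure_le]
    intro s hs
    simpa using h g s hs
  simpa using this hn

theorem aux_closure_comm {G : Type} [Group G] (S : Set G)
    (h : ∀ x ∈ S, ∀ y ∈ S, x * y = y * x) :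
    ∀ x ∈ Subgroup.closure S, ∀ y ∈ Subgroup.closure S, x * y = y * x := by
  intro x hx y hy
  have := Subgroup.isMulCommutative_closure h
  have := this.1.1 ⟨x, hx⟩ ⟨y, hy⟩
  simpa using this

theorem aux_cyc {C : Type} [Group C] [Finite C] [IsCyclic C] {p : ℕ} (hp : 0 < p) {z x : C}
    (hz : orderOf z = p) (hx : x ^ p = 1) : x ∈ Subgroup.zpowers z := by
  have := Fintype.ofFinite C
  have h1 := IsCyclic.card_pow_eq_one_le (α := C) hp
  have h2 : (Finset.univ.filter (· ∈ Subgroup.zpowers z)) ⊆ Finset.univ.filter (fun a : C => a ^ p = 1) := by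
    intro y hy
    simp only [Finset.mem_filter, Finset.mem_univ, true_and] at hy ⊢
    obtain ⟨k, rfl⟩ := hy
    rw [← hz]
    simp only
    rw [← zpow_natCast, ← zpow_mul, mul_comm, zpow_mul, zpow_natCast, pow_orderOf_eq_one, one_zpow]
  have h3 : (Finset.univ.filter (· ∈ Subgroup.zpowers z)).card = p := by
    rw [← hz, ← Nat.card_zpowers, ← Fintype.card_subtype, Nat.card_eq_fintype_card]
  have h4 := Finset.eq_of_subset_of_card_le h2 (by rw [h3]; exact h1)
  have : x ∈ Finset.univ.filter (fun a : C => a ^ p = 1) := by simp [hx]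
  rw [← h4] at this
  simpa using this

/-- hypothesis -/
def Roq (G : Type) [Group G] : Prop :=
  ∀ A : Subgroup G, A.Normal → (∀ x ∈ A, ∀ y ∈ A, x * y = y * x) → IsCyclic A

theorem aux_noncyc {G : Type} [Group G] [Finite G] (hR : Roq G) {p : ℕ} (hp : 0 < p) {z w : G}
    (hz : orderOf z = p) (hw : w ^ p = 1) (hzw : z * w = w * z)
    (h1 : ∀ g, g * z * g⁻¹ ∈ Subgroup.closure {z, w})
    (h2 : ∀ g, g * w * g⁻¹ ∈ Subgroup.closure {z, w}) : w ∈ Subgroup.zpowers z := by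
  have hc := hR (Subgroup.closure {z, w})
    (aux_closure_normal _ (by rintro g s (rfl | rfl); exacts [h1 g, h2 g]))
    (aux_closure_comm _ (by rintro x (rfl | rfl) y (rfl | rfl) <;> simp [hzw]))
  have hzm : z ∈ Subgroup.closure {z, w} := Subgroup.subset_closure (by simp)
  have hwm : w ∈ Subgroup.closure {z, w} := Subgroup.subset_closure (by simp)
  have := aux_cyc (C := Subgroup.closure {z, w}) hp (z := ⟨z, hzm⟩) (x := ⟨w, hwm⟩)
    (by rw [← hz, Subgroup.orderOf_mk]) (by ext; simpa using hw)
  obtain ⟨k, hk⟩ := this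
  exact ⟨k, by simpa using congrArg Subtype.val hk⟩

theorem aux_exists {G : Type} [Group G] [Finite G] [Group.IsNilpotent G] :
    ∃ A : Subgroup G, A.Normal ∧ (∀ x ∈ A, ∀ y ∈ A, x * y = y * x) ∧
      ∀ x, (∀ y ∈ A, x * y = y * x) → x ∈ A := by
  obtain ⟨A, hA⟩ := (Set.toFinite {A : Subgroup G | A.Normal ∧ ∀ x ∈ A, ∀ y ∈ A, x * y = y * x}).exists_maximal
    ⟨⊥, inferInstance, by intro x hx y hy; simp_all⟩
  obtain ⟨⟨hn, hc⟩, hmax⟩ := hA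
  refine ⟨A, hn, hc, ?_⟩
  by_contra! hcon
  have hex : ∃ n, ∃ x ∈ Subgroup.upperCentralSeries G n, (∀ y ∈ A, x * y = y * x) ∧ x ∉ A := by
    obtain ⟨x, hx⟩ := hcon
    obtain ⟨n, hn⟩ := Group.IsNilpotent.nilpotent (G := G)
    exact ⟨n, x, by rw [hn]; trivial, hx⟩
  obtain ⟨x, hxn, hxc, hxA⟩ := Nat.find_spec hex
  have hmin := fun m => Nat.find_min (m := m) hex
  rcases hN : Nat.find hex with _ | N
  · rw [hN] at hxn
    simp at hxn
    exact hxA (hxn ▸ A.one_mem)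
  rw [hN] at hxn
  rw [Subgroup.mem_upperCentralSeries_succ_iff] at hxn
  have hcomm : ∀ g, g * x * g⁻¹ * x⁻¹ ∈ A := by
    intro g
    by_contra hg
    refine hmin N (by omega) ⟨g * x * g⁻¹ * x⁻¹, ?_, ?_, hg⟩
    · have := inv_mem (hxn g)
      convert this using 1
      group
    · intro y hy
      have e1 : x * y * x⁻¹ = y := by rw [hxc y hy]; group
      have e2 : x⁻¹ * y * x = y := by rw [mul_assoc, ← hxc y hy]; group
      have e3 := hxc _ (hn.conj_mem y hy g⁻¹)
      have e4 : g * x * (g⁻¹ * y * g⁻¹⁻¹) * x⁻¹ * g⁻¹ = y := by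
        rw [mul_assoc g, e3]; group
      calc g * x * g⁻¹ * x⁻¹ * y = g * x * g⁻¹ * (x⁻¹ * y * x) * x⁻¹ := by group
        _ = (g * x * (g⁻¹ * y * g⁻¹⁻¹) * x⁻¹ * g⁻¹) * (g * x * g⁻¹ * x⁻¹) := by rw [e2]; group
        _ = _ := by rw [e4]
  have hle : A ≤ Subgroup.closure (insert x (A : Set G)) := fun y hy => Subgroup.subset_closure (by simp [hy])
  have hxm : x ∈ Subgroup.closure (insert x (A : Set G)) := Subgroup.subset_closure (by simp)
  refine hxA (hmax (y := Subgroup.closure (insert x (A : Set G))) ⟨?_, ?_⟩ hle hxm)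
  · apply aux_closure_normal
    rintro g s (rfl | hs)
    · have := mul_mem (hle (hcomm g)) hxm
      simpa using this
    · exact hle (hn.conj_mem s hs g)
  · apply aux_closure_comm
    rintro y (rfl | hy) z (rfl | hz)
    · rfl
    · exact hxc z hz
    · exact (hxc y hy).symm
    · exact hc y hy z hz

theorem aux_claim {G : Type} [Group G] [Finite G] (hR : Roq G) {p : ℕ} (hp : p.Prime) {a : G}
    {n : ℕ} (ha : orderOf a = p ^ n) (hN : (Subgroup.zpowers a).Normal)
    (hC : ∀ x, x * a = a * x → x ∈ Subgroup.zpowers a) {g : G} (hg : g ∉ Subgroup.zpowers a)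
    (hgp : g ^ p ∈ Subgroup.zpowers a) {u : ℤ} (hu : g * a * g⁻¹ = a ^ u)
    (h1 : (p : ℤ) ∣ u - 1) (h2 : p = 2 → (4:ℤ) ∣ u - 1) : False := by
  have hpZ : Prime (p : ℤ) := Nat.prime_iff_prime_int.mp hp
  have key : ∀ i : ℤ, a ^ i = 1 ↔ (p : ℤ) ^ n ∣ i := by
    intro i; rw [← orderOf_dvd_iff_zpow_eq_one, ha]; push_cast; rfl
  obtain ⟨s, hs, hsp⟩ := aux_sum p hp u h1 h2
  have hun : ¬ (p : ℤ) ^ n ∣ u - 1 := by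
    intro h
    rw [← key, zpow_sub, zpow_one, mul_inv_eq_one, ← hu] at h
    exact hg (hC g (by rw [mul_inv_eq_iff_eq_mul] at h; exact h))
  obtain ⟨n, rfl⟩ : ∃ n', n = n' + 1 := by
    cases n with
    | zero => simp at hun
    | succ n => exact ⟨n, rfl⟩
  obtain ⟨i, hi⟩ := hgp
  simp only at hi
  have hup : (p : ℤ) ^ (n+1) ∣ u ^ p - 1 := by
    have := aux_conj_pow hu p
    rw [← hi] at this
    rw [← key, zpow_sub, ← this]
    group
  have hun' : (p : ℤ) ^ n ∣ u - 1 := by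
    rw [← geom_sum_mul, hs, pow_succ', mul_assoc] at hup
    have := (mul_dvd_mul_iff_left hpZ.ne_zero).mp hup
    exact (hsp.symm.pow_left).dvd_of_dvd_mul_left this
  have hpi : (p : ℤ) ∣ i := by
    have e : (p : ℤ) ^ (n+1) ∣ (u - 1) * i := by
      have e1 := aux_conj_zpow hu i
      have : g * a ^ i * g⁻¹ = a ^ i := by rw [hi]; group
      rw [this] at e1
      rw [← key, sub_mul, zpow_sub, ← e1]; group
    obtain ⟨v, hv⟩ := hun'
    rw [hv, pow_succ, mul_assoc] at e
    have e := (mul_dvd_mul_iff_left (pow_ne_zero n hpZ.ne_zero)).mp e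
    refine (hpZ.dvd_or_dvd e).resolve_left fun hh => hun ?_
    rw [hv, pow_succ]
    exact mul_dvd_mul_left _ hh
  obtain ⟨i', rfl⟩ := hpi
  -- choose j
  obtain ⟨x, y, hxy⟩ := (hsp.pow_right : IsCoprime s ((p:ℤ) ^ (n+1)))
  obtain ⟨w, hw⟩ : ∃ w, w = a ^ (-i' * x) * g := ⟨_, rfl⟩
  have haA : ∀ j : ℤ, a ^ j ∈ Subgroup.zpowers a := fun j => ⟨j, rfl⟩
  have hwA : w ∉ Subgroup.zpowers a := by
    rw [hw, Subgroup.mul_mem_cancel_left _ (haA _)]; exact hg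
  have hwa : w * a * w⁻¹ = a ^ u := by
    have : w * a * w⁻¹ = a ^ (-i' * x) * (g * a * g⁻¹) * (a ^ (-i' * x))⁻¹ := by rw [hw]; group
    rw [this, hu]; group
  have hwp : w ^ p = 1 := by
    rw [hw, aux_mul_pow hu, ← hi, hs, ← zpow_add, key]
    exact ⟨p * i' * y, by linear_combination (-p*i') * hxy⟩
  obtain ⟨z, hz⟩ : ∃ z, z = a ^ ((p : ℤ) ^ n) := ⟨_, rfl⟩
  have hzo : orderOf z = p := by
    refine orderOf_eq_prime_iff (hp := ⟨hp⟩) |>.mpr ⟨?_, ?_⟩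
    · rw [hz, ← zpow_natCast, ← zpow_mul, key, pow_succ]
    · rw [hz, Ne, key, pow_succ]
      intro h
      nth_rewrite 2 [← mul_one ((p:ℤ)^n)] at h
      have h := (mul_dvd_mul_iff_left (pow_ne_zero n hpZ.ne_zero)).mp h
      exact hpZ.not_isUnit (isUnit_of_dvd_one h)
  have hzw : z * w = w * z := by
    have e1 := aux_conj_zpow hwa ((p:ℤ)^n)
    have e2 : a ^ (u * (p:ℤ)^n) = a ^ ((p:ℤ)^n) := by
      rw [← mul_inv_eq_one, ← zpow_sub, key]
      obtain ⟨v, hv⟩ := h1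
      exact ⟨v, by linear_combination (p:ℤ)^n * hv⟩
    rw [e2, ← hz] at e1
    rw [← mul_inv_eq_iff_eq_mul.mp e1]
  have hzm : z ∈ Subgroup.closure {z, w} := Subgroup.subset_closure (by simp)
  have hwm : w ∈ Subgroup.closure {z, w} := Subgroup.subset_closure (by simp)
  have hfin := aux_noncyc hR hp.pos hzo hwp hzw ?_ ?_
  · have : Subgroup.zpowers z ≤ Subgroup.zpowers a := by
      rw [Subgroup.zpowers_le, hz]; exact haA _
    exact hwA (this hfin)
  · intro h
    obtain ⟨k, hk⟩ := hN.conj_mem a ⟨1, by simp⟩ h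
    have := aux_conj_zpow hk.symm ((p:ℤ)^n)
    rw [mul_comm, zpow_mul, ← hz] at this
    rw [this]
    exact zpow_mem hzm k
  · intro h
    obtain ⟨l, hl⟩ := hN.conj_mem a ⟨1, by simp⟩ h⁻¹
    simp only [inv_inv] at hl
    have e1 : (h * w * h⁻¹) * a * (h * w * h⁻¹)⁻¹ = a ^ u := by
      calc (h * w * h⁻¹) * a * (h * w * h⁻¹)⁻¹ = h * (w * (h⁻¹ * a * h) * w⁻¹) * h⁻¹ := by group
        _ = h * ((a ^ l) ^ u) * h⁻¹ := by
            rw [← hl, aux_conj_zpow hwa, mul_comm, zpow_mul]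
        _ = a ^ u := by rw [hl, ← conj_zpow]; group
    have e2 : (h * w * h⁻¹) * w⁻¹ ∈ Subgroup.zpowers a := by
      have e0 : w⁻¹ * (h * w * h⁻¹) ∈ Subgroup.zpowers a := by
        apply hC
        rw [← mul_inv_eq_iff_eq_mul]
        calc w⁻¹ * (h * w * h⁻¹) * a * (w⁻¹ * (h * w * h⁻¹))⁻¹ =
            w⁻¹ * ((h * w * h⁻¹) * a * (h * w * h⁻¹)⁻¹) * w := by group
          _ = a := by rw [e1, ← hwa]; group
      have := hN.conj_mem _ e0 w
      rwa [mul_inv_cancel_left] at this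
    obtain ⟨j, hj⟩ := e2
    simp only at hj
    have e4 : h * w * h⁻¹ = a ^ j * w := by rw [hj]; group
    rw [e4]
    have e5 : (h * w * h⁻¹) ^ p = 1 := by rw [conj_pow, hwp]; group
    rw [e4, aux_mul_pow hwa, hwp, mul_one, key, hs, pow_succ'] at e5
    have e6 : (p:ℤ)^n ∣ j * s := by
      rw [mul_left_comm] at e5
      exact (mul_dvd_mul_iff_left hpZ.ne_zero).mp e5
    obtain ⟨t, rfl⟩ := (hsp.symm.pow_left).dvd_of_dvd_mul_right e6
    rw [zpow_mul, ← hz]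
    exact mul_mem (zpow_mem hzm t) hwm

theorem aux_claim2 {G : Type} [Group G] [Finite G] (hR : Roq G) {p : ℕ} (hp : p.Prime)
    (hG : IsPGroup p G) {a : G}
    {n : ℕ} (ha : orderOf a = p ^ n) (hN : (Subgroup.zpowers a).Normal)
    (hC : ∀ x, x * a = a * x → x ∈ Subgroup.zpowers a) {g : G} {u : ℤ} (hu : g * a * g⁻¹ = a ^ u)
    (h1 : (p : ℤ) ∣ u - 1) (h2 : p = 2 → (4:ℤ) ∣ u - 1) : g ∈ Subgroup.zpowers a := by
  by_contra hg
  have hex : ∃ t, g ^ p ^ t ∈ Subgroup.zpowers a := by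
    obtain ⟨t, ht⟩ := hG g
    exact ⟨t, ht ▸ one_mem _⟩
  have hs := Nat.find_spec hex
  have hm := fun m => Nat.find_min (m := m) hex
  rcases hT : Nat.find hex with _ | T
  · rw [hT] at hs; simp only [pow_zero, pow_one] at hs; exact hg hs
  · rw [hT, pow_succ, pow_mul] at hs
    have hd : u - 1 ∣ u ^ p ^ T - 1 := sub_one_dvd_pow_sub_one u _
    exact aux_claim hR hp ha hN hC (hm T (by omega)) hs (aux_conj_pow hu _) (h1.trans hd)
      (fun h => (h2 h).trans hd)

theorem aux_mod_p {G : Type} [Group G] {p : ℕ} (hp : p.Prime)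
    (hG : IsPGroup p G) {a : G}
    {n : ℕ} (ha : orderOf a = p ^ (n+1)) {g : G} {u : ℤ} (hu : g * a * g⁻¹ = a ^ u) :
    (p : ℤ) ∣ u - 1 := by
  have : Fact p.Prime := ⟨hp⟩
  obtain ⟨t, ht⟩ := hG g
  have h := aux_conj_pow hu (p ^ t)
  rw [ht] at h
  have h2 : (p : ℤ) ^ (n+1) ∣ u ^ p ^ t - 1 := by
    have : a ^ (u ^ p ^ t - 1) = 1 := by rw [zpow_sub, ← h]; group
    rw [← orderOf_dvd_iff_zpow_eq_one, ha] at this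
    exact_mod_cast this
  have h3 : (p : ℤ) ∣ u ^ p ^ t - 1 := (dvd_pow_self _ (by simp)).trans h2
  rw [← ZMod.intCast_zmod_eq_zero_iff_dvd] at h3 ⊢
  push_cast at h3 ⊢
  rwa [ZMod.pow_card_pow] at h3

/-- zpow on ZMod -/
def zf {G : Type} [Group G] (a : G) (N : ℕ) (x : ZMod N) : G := a ^ (x.cast : ℤ)

theorem zf_int {G : Type} [Group G] {a : G} {N : ℕ} (h : orderOf a = N) (i : ℤ) :
    zf a N (i : ZMod N) = a ^ i := by
  rw [zf, ZMod.coe_intCast, ← h, zpow_mod_orderOf]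

theorem zf_inj {G : Type} [Group G] {a : G} {N : ℕ} (h : orderOf a = N) {x y : ZMod N}
    (hxy : zf a N x = zf a N y) : x = y := by
  obtain ⟨i, rfl⟩ := ZMod.intCast_surjective x
  obtain ⟨j, rfl⟩ := ZMod.intCast_surjective y
  rw [zf_int h, zf_int h, zpow_eq_zpow_iff_modEq, h] at hxy
  exact (ZMod.intCast_eq_intCast_iff i j N).mpr hxy

theorem iso_dih {G : Type} [Group G] {a g : G} {N : ℕ} (ha : orderOf a = N)
    (hg : g ∉ Subgroup.zpowers a) (hall : ∀ x, x ∈ Subgroup.zpowers a ∨ g⁻¹ * x ∈ Subgroup.zpowers a)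
    (hga : g * a * g⁻¹ = a ^ (-1 : ℤ)) (hg2 : g * g = 1) : Nonempty (G ≃* DihedralGroup N) := by
  have hmem : ∀ i : ZMod N, zf a N i ∈ Subgroup.zpowers a := fun i => ⟨_, rfl⟩
  have hm : ∀ i : ℤ, a ^ i * g = g * a ^ (-i) := by
    intro i
    have := aux_conj_zpow hga (-i)
    rw [mul_inv_eq_iff_eq_mul] at this
    rw [this]; simp
  let F : DihedralGroup N → G := fun x => match x with
    | .r i => zf a N i
    | .sr i => g * zf a N i
  have hF : ∀ x y, F (x * y) = F x * F y := by
    rintro (x | x) (y | y) <;> obtain ⟨i, rfl⟩ := ZMod.intCast_surjective x <;>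
      obtain ⟨j, rfl⟩ := ZMod.intCast_surjective y
    · simp only [DihedralGroup.r_mul_r, F]
      rw [← Int.cast_add, zf_int ha, zf_int ha, zf_int ha, zpow_add]
    · simp only [DihedralGroup.r_mul_sr, F]
      rw [← Int.cast_sub, zf_int ha, zf_int ha, zf_int ha, ← mul_assoc, hm, mul_assoc, ← zpow_add]
      congr 2; ring
    · simp only [DihedralGroup.sr_mul_r, F]
      rw [← Int.cast_add, zf_int ha, zf_int ha, zf_int ha, mul_assoc, ← zpow_add]
    · simp only [DihedralGroup.sr_mul_sr, F]
      rw [← Int.cast_sub, zf_int ha, zf_int ha, zf_int ha, mul_assoc, ← mul_assoc _ g, hm,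
        ← mul_assoc, ← mul_assoc, hg2, one_mul, ← zpow_add]
      congr 1; ring
  refine ⟨(MulEquiv.ofBijective (MonoidHom.mk' F hF) ⟨?_, ?_⟩).symm⟩
  · rintro (x | x) (y | y) h <;> simp only [MonoidHom.mk'_apply, F] at h
    · rw [zf_inj ha h]
    · exact absurd ((Subgroup.mul_mem_cancel_right _ (hmem y)).mp (h ▸ hmem x)) hg
    · exact absurd ((Subgroup.mul_mem_cancel_right _ (hmem x)).mp (h ▸ hmem y)) hg
    · rw [zf_inj ha (mul_left_cancel h)]
  · intro x
    rcases hall x with ⟨i, hi⟩ | ⟨i, hi⟩ <;> simp only at hi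
    · exact ⟨.r (i : ZMod N), by simp only [MonoidHom.mk'_apply, F]; rw [zf_int ha, hi]⟩
    · exact ⟨.sr (i : ZMod N), by simp only [MonoidHom.mk'_apply, F]; rw [zf_int ha, hi]; group⟩

theorem iso_quat {G : Type} [Group G] {a g : G} {N : ℕ} (ha : orderOf a = 2 * N)
    (hg : g ∉ Subgroup.zpowers a) (hall : ∀ x, x ∈ Subgroup.zpowers a ∨ g⁻¹ * x ∈ Subgroup.zpowers a)
    (hga : g * a * g⁻¹ = a ^ (-1 : ℤ)) (hg2 : g * g = a ^ (N : ℤ)) :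
    Nonempty (G ≃* QuaternionGroup N) := by
  have hmem : ∀ i : ZMod (2 * N), zf a (2 * N) i ∈ Subgroup.zpowers a := fun i => ⟨_, rfl⟩
  have hm : ∀ i : ℤ, a ^ i * g = g * a ^ (-i) := by
    intro i
    have := aux_conj_zpow hga (-i)
    rw [mul_inv_eq_iff_eq_mul] at this
    rw [this]; simp
  let F : QuaternionGroup N → G := fun x => match x with
    | .a i => zf a (2 * N) i
    | .xa i => g * zf a (2 * N) i
  have hF : ∀ x y, F (x * y) = F x * F y := by
    rintro (x | x) (y | y) <;> obtain ⟨i, rfl⟩ := ZMod.intCast_surjective x <;>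
      obtain ⟨j, rfl⟩ := ZMod.intCast_surjective y
    · simp only [QuaternionGroup.a_mul_a, F]
      rw [← Int.cast_add, zf_int ha, zf_int ha, zf_int ha, zpow_add]
    · simp only [QuaternionGroup.a_mul_xa, F]
      rw [← Int.cast_sub, zf_int ha, zf_int ha, zf_int ha, ← mul_assoc, hm, mul_assoc, ← zpow_add]
      congr 2; ring
    · simp only [QuaternionGroup.xa_mul_a, F]
      rw [← Int.cast_add, zf_int ha, zf_int ha, zf_int ha, mul_assoc, ← zpow_add]
    · simp only [QuaternionGroup.xa_mul_xa, F]
      rw [← Int.cast_natCast, ← Int.cast_add, ← Int.cast_sub, zf_int ha, zf_int ha, zf_int ha,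
        mul_assoc, ← mul_assoc _ g, hm,
        ← mul_assoc, ← mul_assoc, hg2, ← zpow_add, ← zpow_add]
      congr 1; ring
  refine ⟨(MulEquiv.ofBijective (MonoidHom.mk' F hF) ⟨?_, ?_⟩).symm⟩
  · rintro (x | x) (y | y) h <;> simp only [MonoidHom.mk'_apply, F] at h
    · rw [zf_inj ha h]
    · exact absurd ((Subgroup.mul_mem_cancel_right _ (hmem y)).mp (h ▸ hmem x)) hg
    · exact absurd ((Subgroup.mul_mem_cancel_right _ (hmem x)).mp (h ▸ hmem y)) hg
    · rw [zf_inj ha (mul_left_cancel h)]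
  · intro x
    rcases hall x with ⟨i, hi⟩ | ⟨i, hi⟩ <;> simp only at hi
    · exact ⟨.a (i : ZMod (2 * N)), by simp only [MonoidHom.mk'_apply, F]; rw [zf_int ha, hi]⟩
    · exact ⟨.xa (i : ZMod (2 * N)), by simp only [MonoidHom.mk'_apply, F]; rw [zf_int ha, hi]; group⟩

/-- first generator -/
def sdA (m : ℕ) : SemidihedralGroup m := PresentedGroup.of 0
/-- second generator -/
def sdD (m : ℕ) : SemidihedralGroup m := PresentedGroup.of 1

theorem sd_rel1 (m : ℕ) : sdA m ^ 2 ^ (m - 1) = 1 :=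
  PresentedGroup.one_of_mem (rels := sdRels m) (x := FreeGroup.of 0 ^ 2 ^ (m - 1)) (by simp [sdRels])

theorem sd_rel2 (m : ℕ) : sdD m ^ 2 = 1 :=
  PresentedGroup.one_of_mem (rels := sdRels m) (x := FreeGroup.of 1 ^ 2) (by simp [sdRels])

theorem sd_rel3 (m : ℕ) : sdD m * sdA m * (sdD m)⁻¹ = sdA m ^ (2 ^ (m - 2) - 1) := by
  have := PresentedGroup.one_of_mem (rels := sdRels m) (x := FreeGroup.of 1 * FreeGroup.of 0 * (FreeGroup.of 1)⁻¹ *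
      (FreeGroup.of 0 ^ (2 ^ (m - 2) - 1))⁻¹) (by simp [sdRels])
  exact mul_inv_eq_one.mp this

theorem sd_all (m : ℕ) (x : SemidihedralGroup m) :
    x ∈ Subgroup.zpowers (sdA m) ∨ (sdD m)⁻¹ * x ∈ Subgroup.zpowers (sdA m) := by
  have h3 : sdD m * sdA m * (sdD m)⁻¹ = sdA m ^ (((2 ^ (m - 2) - 1 : ℕ)) : ℤ) := by
    rw [zpow_natCast, sd_rel3]
  have h2 : (sdD m)⁻¹ = sdD m := by
    rw [inv_eq_iff_mul_eq_one, ← sq, sd_rel2]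
  have hx : x ∈ Subgroup.closure (Set.range (PresentedGroup.of (rels := sdRels m))) := by
    rw [PresentedGroup.closure_range_of]; trivial
  rw [h2]
  have hmA : sdA m ∈ Subgroup.zpowers (sdA m) := ⟨1, by simp⟩
  have hc : ∀ y ∈ Subgroup.zpowers (sdA m), sdD m * y * sdD m ∈ Subgroup.zpowers (sdA m) := by
    rintro _ ⟨i, rfl⟩
    have := aux_conj_zpow h3 i
    rw [h2] at this
    simp only
    rw [this]
    exact ⟨_, rfl⟩
  have h2' : sdD m * sdD m = 1 := by rw [← sq, sd_rel2]
  induction hx using Subgroup.closure_induction with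
  | mem x h =>
    obtain ⟨i, rfl⟩ := h
    fin_cases i
    · exact Or.inl hmA
    · right
      change sdD m * sdD m ∈ _
      rw [h2']; exact one_mem _
  | one => exact Or.inl (one_mem _)
  | mul x y _ _ hx hy =>
    rcases hx with hx | hx <;> rcases hy with hy | hy
    · exact Or.inl (mul_mem hx hy)
    · right
      have := mul_mem (hc _ hx) hy
      rwa [show sdD m * x * sdD m * (sdD m * y) = sdD m * x * (sdD m * sdD m) * y by group, h2', mul_one,
        mul_assoc] at this
    · right
      rw [← mul_assoc]; exact mul_mem hx hy
    · left
      have := mul_mem (hc _ hx) hy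
      rwa [show sdD m * (sdD m * x) * sdD m * (sdD m * y) = (sdD m * sdD m) * x * (sdD m * sdD m) * y by group, h2', mul_one,
        one_mul] at this
  | inv x _ hx =>
    rcases hx with hx | hx
    · exact Or.inl (inv_mem hx)
    · right
      have := hc _ (inv_mem hx)
      rwa [mul_inv_rev, h2, mul_assoc, mul_assoc, h2', mul_one] at this

theorem iso_sd {G : Type} [Group G] {a g : G} {m : ℕ} (ha : orderOf a = 2 ^ (m - 1))
    (hg : g ∉ Subgroup.zpowers a) (hall : ∀ x, x ∈ Subgroup.zpowers a ∨ g⁻¹ * x ∈ Subgroup.zpowers a)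
    (hga : g * a * g⁻¹ = a ^ (2 ^ (m - 2) - 1)) (hg2 : g * g = 1) :
    Nonempty (G ≃* SemidihedralGroup m) := by
  have hr : ∀ r ∈ sdRels m, FreeGroup.lift ![a, g] r = 1 := by
    rintro r (rfl | rfl | rfl)
    · simp [← ha, pow_orderOf_eq_one]
    · simp [sq, hg2]
    · simp [hga]
  let F : SemidihedralGroup m →* G := PresentedGroup.toGroup hr
  have hA : F (sdA m) = a := by
    change PresentedGroup.toGroup hr (PresentedGroup.of 0) = _
    simp
  have hD : F (sdD m) = g := by
    change PresentedGroup.toGroup hr (PresentedGroup.of 1) = _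
    simp
  refine ⟨(MulEquiv.ofBijective F ⟨?_, ?_⟩).symm⟩
  · rw [injective_iff_map_eq_one]
    intro x hx
    rcases sd_all m x with ⟨i, hi⟩ | ⟨i, hi⟩ <;> simp only at hi
    · rw [← hi, map_zpow, hA, ← orderOf_dvd_iff_zpow_eq_one, ha] at hx
      obtain ⟨t, rfl⟩ := hx
      rw [← hi, zpow_mul, zpow_natCast, sd_rel1, one_zpow]
    · exfalso
      have := congrArg F hi
      rw [map_zpow, map_mul, map_inv, hA, hD, hx, mul_one] at this
      exact hg (by rw [← inv_mem_iff]; exact ⟨i, this⟩)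
  · intro x
    rcases hall x with ⟨i, hi⟩ | ⟨i, hi⟩ <;> simp only at hi
    · exact ⟨sdA m ^ i, by rw [map_zpow, hA, hi]⟩
    · exact ⟨sdD m * sdA m ^ i, by rw [map_mul, map_zpow, hA, hD, hi]; group⟩

theorem sd_order (m : ℕ) (hm : 4 ≤ m) : orderOf (sdA m) = 2 ^ (m - 1) := by
  obtain ⟨q, rfl⟩ : ∃ q, m = q + 4 := ⟨m - 4, by omega⟩
  let N := 2 ^ (q + 3)
  have hN : ((2 : ZMod N)) ^ (q + 3) = 0 := by
    have : ((2 ^ (q + 3) : ℕ) : ZMod N) = 0 := ZMod.natCast_self N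
    rwa [Nat.cast_pow, Nat.cast_ofNat] at this
  let k : ZMod N := 2 ^ (q + 2) - 1
  have hk : k * k = 1 := by
    simp only [k]; linear_combination (2 ^ (q+1) - 1) * hN
  let d : Equiv.Perm (ZMod N) := ⟨fun x => k * x, fun x => k * x,
    fun x => by simp only [← mul_assoc, hk, one_mul], fun x => by simp only [← mul_assoc, hk, one_mul]⟩
  let a : Equiv.Perm (ZMod N) := Equiv.addRight 1
  have hpow : ∀ (t : ℕ) x, (a ^ t) x = x + t := by
    intro t
    induction t with
    | zero => simp
    | succ t ih =>
      intro x
      rw [pow_succ', Equiv.Perm.mul_apply, ih]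
      simp [a]; ring
  have hdd : d * d = 1 := by
    ext x; simp [d, ← mul_assoc, hk]
  have hdi : d⁻¹ = d := by rw [inv_eq_iff_mul_eq_one, hdd]
  have hr : ∀ r ∈ sdRels (q + 4), FreeGroup.lift ![a, d] r = 1 := by
    rintro r (rfl | rfl | rfl)
    · simp only [map_pow, FreeGroup.lift_apply_of, Matrix.cons_val_zero]
      ext1 x
      rw [hpow]
      simp
    · simp [sq, hdd]
    · simp only [map_mul, map_inv, map_pow, FreeGroup.lift_apply_of, Matrix.cons_val_zero, Matrix.cons_val_one]
      rw [mul_inv_eq_one, hdi]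
      ext1 x
      rw [hpow]
      simp [a, d, mul_add, ← mul_assoc, hk]
      simp [k]
  let F : SemidihedralGroup (q + 4) →* _ := PresentedGroup.toGroup hr
  have hA : F (sdA (q + 4)) = a := by
    change PresentedGroup.toGroup hr (PresentedGroup.of 0) = _
    simp
  apply Nat.dvd_antisymm (orderOf_dvd_of_pow_eq_one (sd_rel1 _))
  have h1 : a ^ orderOf (sdA (q + 4)) = 1 := by
    rw [← hA, ← map_pow, pow_orderOf_eq_one, map_one]
  have h2 := congrArg (fun e => e 0) h1
  simp only [hpow, Equiv.Perm.one_apply, zero_add] at h2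
  exact (ZMod.natCast_eq_zero_iff _ _).mp h2

theorem roq_of_le {G : Type} [Group G] {C A : Subgroup G} [IsCyclic C] (h : A ≤ C) : IsCyclic A :=
  isCyclic_of_injective (Subgroup.inclusion h) (Subgroup.inclusion_injective h)

theorem roq_equiv {G H : Type} [Group G] [Group H] (e : G ≃* H) (hH : Roq H) : Roq G := by
  intro A hA hc
  have := hH (A.map e.toMonoidHom) (hA.map _ e.surjective) (by
    rintro _ ⟨x, hx, rfl⟩ _ ⟨y, hy, rfl⟩
    rw [← map_mul, hc x hx y hy, map_mul])
  exact isCyclic_of_injective (A.equivMapOfInjective e.toMonoidHom e.injective).toMonoidHom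
    (MulEquiv.injective _)

theorem roq_rev {G : Type} [Group G] {a g : G} {n : ℕ} (hn : 3 ≤ n) (ha : orderOf a = 2 ^ n)
    (hall : ∀ x, x ∈ Subgroup.zpowers a ∨ g⁻¹ * x ∈ Subgroup.zpowers a) {k : ℤ}
    (hga : g * a * g⁻¹ = a ^ k) (hk : 4 ∣ k + 1) : Roq G := by
  intro A hA hc
  refine roq_of_le (C := Subgroup.zpowers a) ?_
  intro x hx
  by_contra hxa
  obtain ⟨i, hi⟩ := (hall x).resolve_left hxa
  simp only at hi
  have hxg : x = g * a ^ i := by rw [hi]; group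
  have hxa : x * a * x⁻¹ = a ^ k := by
    rw [← hga, hxg]; group
  have h1 : a ^ (1 - k) ∈ A := by
    have := mul_mem (hA.conj_mem x hx a) (inv_mem hx)
    have e : a * x * a⁻¹ * x⁻¹ = a ^ (1 - k) := by
      rw [zpow_sub, ← hxa]; group
    rwa [e] at this
  have h2 := hc _ hx _ h1
  have h3 := aux_conj_zpow hxa (1 - k)
  rw [h2, mul_inv_cancel_right, ← mul_inv_eq_one, ← zpow_sub, ← orderOf_dvd_iff_zpow_eq_one, ha] at h3
  have h4 : (8 : ℤ) ∣ (1 - k) - k * (1 - k) := by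
    refine dvd_trans ?_ h3
    exact_mod_cast (pow_dvd_pow 2 hn : 2 ^ 3 ∣ 2 ^ n)
  obtain ⟨t, ht⟩ := hk
  obtain ⟨v, hv⟩ := h4
  obtain rfl : k = 4 * t - 1 := by linarith
  have : 2 * v = 4 * (t ^ 2 - t) + 1 := by linarith
  omega

theorem roq_cyc {G : Type} [Group G] [IsCyclic G] : Roq G := fun _ _ _ => inferInstance

theorem roq_dih (m : ℕ) (hm : 4 ≤ m) : Roq (DihedralGroup (2 ^ (m - 1))) := by
  refine roq_rev (a := .r 1) (g := .sr 0) (n := m - 1) (k := -1) (by omega) DihedralGroup.orderOf_r_one ?_ ?_ (by norm_num)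
  · rintro (x | x) <;> obtain ⟨i, rfl⟩ := ZMod.intCast_surjective x
    · exact Or.inl ⟨i, by simp⟩
    · exact Or.inr ⟨i, by simp⟩
  · simp

theorem roq_sd (m : ℕ) (hm : 4 ≤ m) : Roq (SemidihedralGroup m) := by
  refine roq_rev (a := sdA m) (g := sdD m) (n := m - 1) (k := (2 ^ (m - 2) - 1 : ℕ)) (by omega) (sd_order m hm) (sd_all m) ?_ ?_
  · rw [zpow_natCast, sd_rel3]
  · obtain ⟨q, rfl⟩ : ∃ q, m = q + 4 := ⟨m - 4, by omega⟩
    have : 1 ≤ 2 ^ (q + 4 - 2) := Nat.one_le_two_pow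
    push_cast [this]
    exact ⟨2 ^ q, by simp [pow_succ]; ring⟩

theorem roq_quat (m : ℕ) (hm : 3 ≤ m) : Roq (QuaternionGroup (2 ^ (m - 2))) := by
  rcases hm.eq_or_lt with rfl | hm
  · change Roq (QuaternionGroup 2)
    intro A hA hc
    have key : ∀ x y : QuaternionGroup 2, x * y = y * x →
        (x = .a 0 ∨ x = .a 2) ∨ (y = 1 ∨ y = x ∨ y = x * x ∨ y = x * x * x) := by decide
    by_cases h : ∃ x ∈ A, ¬ (x = .a 0 ∨ x = .a 2)
    · obtain ⟨x, hx, hx2⟩ := h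
      refine roq_of_le (C := Subgroup.zpowers x) ?_
      intro y hy
      rcases (key x y (hc x hx y hy)).resolve_left hx2 with h | h | h | h <;> rw [h]
      · exact one_mem _
      · exact ⟨1, by simp⟩
      · exact ⟨2, zpow_two x⟩
      · exact ⟨3, by simp [pow_succ, zpow_ofNat]⟩
    · have h : ∀ x ∈ A, x = .a 0 ∨ x = .a 2 := fun x hx => by
        by_contra hh; exact h ⟨x, hx, hh⟩
      refine roq_of_le (C := Subgroup.zpowers (.a 1)) ?_
      intro y hy
      by_cases hy0 : y = .a 0
      · rw [hy0]; exact one_mem _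
      · rw [(h y hy).resolve_left hy0]
        exact ⟨2, by decide⟩
  · refine roq_rev (a := .a 1) (g := .xa 0) (n := m - 1) (k := -1) (by omega) ?_ ?_ ?_ (by norm_num)
    · rw [QuaternionGroup.orderOf_a_one, ← pow_succ']; congr 1; omega
    · have hz : ∀ x : ZMod (2 * 2 ^ (m - 2)),
          QuaternionGroup.a x ∈ Subgroup.zpowers (QuaternionGroup.a (1 : ZMod (2 * 2 ^ (m - 2)))) := by
        intro x
        obtain ⟨i, rfl⟩ := ZMod.natCast_zmod_surjective x
        rw [← QuaternionGroup.a_one_pow]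
        exact pow_mem (Subgroup.mem_zpowers _) _
      rintro (x | x)
      · exact Or.inl (hz x)
      · right
        have : QuaternionGroup.xa x = .xa 0 * .a x := by simp
        rw [this, inv_mul_cancel_left]
        exact hz x
    · have h1 : (QuaternionGroup.a (1 : ZMod (2 * 2 ^ (m - 2))))⁻¹ = .a (-1) := by
        apply inv_eq_of_mul_eq_one_right
        rw [QuaternionGroup.a_mul_a, QuaternionGroup.one_def]; simp
      rw [mul_inv_eq_iff_eq_mul, zpow_neg_one, h1]
      simp

theorem roq_fwd {p : ℕ} (hp : p.Prime) {G : Type} [Group G] [Fintype G] (hG : IsPGroup p G)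
    (hR : Roq G) : ((∃ m : ℕ, Nonempty (G ≃* Multiplicative (ZMod (p ^ m)))) ∨
        (∃ m : ℕ, 3 ≤ m ∧ Nonempty (G ≃* QuaternionGroup (2 ^ (m - 2)))) ∨
        (∃ m : ℕ, 4 ≤ m ∧ Nonempty (G ≃* DihedralGroup (2 ^ (m - 1)))) ∨
        (∃ m : ℕ, 4 ≤ m ∧ Nonempty (G ≃* SemidihedralGroup m))) := by
  have : Fact p.Prime := ⟨hp⟩
  have : Group.IsNilpotent G := hG.isNilpotent
  obtain ⟨A, hN, hc, hC⟩ := aux_exists (G := G)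
  have := hR A hN hc
  obtain ⟨a, rfl⟩ := (Subgroup.isCyclic_iff_exists_zpowers_eq_top A).mp this
  obtain ⟨n, ha⟩ := IsPGroup.iff_orderOf.mp hG a
  have hC : ∀ x, x * a = a * x → x ∈ Subgroup.zpowers a := by
    intro x hx
    apply hC
    rintro _ ⟨i, rfl⟩
    exact (Commute.zpow_right (show Commute x a from hx) i).eq
  have hact : ∀ g, ∃ k : ℤ, g * a * g⁻¹ = a ^ k := by
    intro g
    obtain ⟨k, hk⟩ := hN.conj_mem a ⟨1, by simp⟩ g
    exact ⟨k, hk.symm⟩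
  by_cases htop : ∀ g, g ∈ Subgroup.zpowers a
  · left
    have hcy : IsCyclic G := ⟨a, htop⟩
    refine ⟨n, ⟨?_⟩⟩
    apply mulEquivOfCyclicCardEq
    rw [← orderOf_eq_card_of_forall_mem_zpowers htop, ha]
    simp
  push Not at htop
  right
  obtain ⟨n, rfl⟩ : ∃ n', n = n' + 1 := by
    cases n with
    | zero =>
      rw [pow_zero, orderOf_eq_one_iff] at ha
      obtain ⟨g, hg⟩ := htop
      exact absurd (hC g (by simp [ha])) hg
    | succ n => exact ⟨n, rfl⟩
  have hp2 : p = 2 := by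
    by_contra hp2
    obtain ⟨g, hg⟩ := htop
    obtain ⟨k, hk⟩ := hact g
    exact hg (aux_claim2 hR hp hG ha hN hC hk (aux_mod_p hp hG ha hk) (fun h => absurd h hp2))
  subst hp2
  have h34 : ∀ g k, g ∉ Subgroup.zpowers a → g * a * g⁻¹ = a ^ k → (4 : ℤ) ∣ k + 1 := by
    intro g k hg hk
    have h1 := aux_mod_p hp hG ha hk
    by_contra h
    refine hg (aux_claim2 hR hp hG ha hN hC hk h1 (fun _ => ?_))
    push_cast at h1
    omega
  obtain ⟨g, hg⟩ := htop
  have hmul : ∀ x, x ∉ Subgroup.zpowers a → g * x ∈ Subgroup.zpowers a := by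
    intro x hx
    by_contra hgx
    obtain ⟨k, hk⟩ := hact g
    obtain ⟨l, hl⟩ := hact x
    have hkl : (g * x) * a * (g * x)⁻¹ = a ^ (k * l) := by
      rw [← aux_conj_zpow hk, ← hl]; group
    obtain ⟨u, hu⟩ := h34 _ _ hg hk
    obtain ⟨v, hv⟩ := h34 _ _ hx hl
    obtain ⟨w, hw⟩ := h34 _ _ hgx hkl
    obtain rfl : k = 4 * u - 1 := by linarith
    obtain rfl : l = 4 * v - 1 := by linarith
    have : 2 * w = 2 * (4 * u * v - u - v) + 1 := by linarith
    omega
  have hg2 : g * g ∈ Subgroup.zpowers a := hmul g hg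
  have hall : ∀ x, x ∈ Subgroup.zpowers a ∨ g⁻¹ * x ∈ Subgroup.zpowers a := by
    intro x
    by_cases hx : x ∈ Subgroup.zpowers a
    · exact Or.inl hx
    · right
      have := mul_mem (inv_mem hg2) (hmul x hx)
      rwa [show (g * g)⁻¹ * (g * x) = g⁻¹ * x by group] at this
  have key : ∀ i : ℤ, a ^ i = 1 ↔ (2 : ℤ) ^ (n + 1) ∣ i := by
    intro i; rw [← orderOf_dvd_iff_zpow_eq_one, ha]; push_cast; rfl
  have keq : ∀ i j : ℤ, a ^ i = a ^ j ↔ (2 : ℤ) ^ (n + 1) ∣ i - j := by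
    intro i j; rw [← key, zpow_sub, mul_inv_eq_one]
  obtain ⟨k, hk⟩ := hact g
  obtain ⟨i, hi⟩ := hg2
  simp only at hi
  obtain ⟨u, hu⟩ := h34 _ _ hg hk
  obtain rfl : k = 4 * u - 1 := by linarith
  have hodd : IsCoprime (2 * u - 1) ((2 : ℤ) ^ n) := IsCoprime.pow_right ⟨-1, u, by ring⟩
  -- 2^n | k+1
  have hk1 : (2 : ℤ) ^ n ∣ 4 * u := by
    have h := aux_conj_pow hk 2
    rw [sq g, ← hi] at h
    have h : a ^ (1 : ℤ) = a ^ ((4 * u - 1) ^ 2) := by rw [← h]; group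
    rw [keq] at h
    obtain ⟨c, hc⟩ := h
    have h : (2 : ℤ) * 2 ^ n ∣ 2 * ((2 * u - 1) * (4 * u)) := ⟨-c, by linear_combination -hc⟩
    have h := (mul_dvd_mul_iff_left (by norm_num)).mp h
    exact hodd.symm.dvd_of_dvd_mul_left h
  have hi1 : (2 : ℤ) ^ n ∣ i := by
    have h := aux_conj_zpow hk i
    have h : a ^ ((4 * u - 1) * i) = a ^ i := by rw [← h, hi]; group
    rw [keq, pow_succ'] at h
    have h : (2 : ℤ) * 2 ^ n ∣ 2 * ((2 * u - 1) * i) := by convert h using 1; ring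
    have h := (mul_dvd_mul_iff_left (by norm_num)).mp h
    exact hodd.symm.dvd_of_dvd_mul_left h
  have hn1 : 1 ≤ n := by
    by_contra h0
    obtain rfl : n = 0 := by omega
    refine hg (hC g ?_)
    rw [← mul_inv_eq_iff_eq_mul, hk]
    nth_rewrite 2 [← zpow_one a]
    rw [keq]
    exact ⟨2 * u - 1, by ring⟩
  obtain ⟨t, ht⟩ := hk1
  obtain ⟨s, rfl⟩ := hi1
  have hpar : ∀ x y : ℤ, a ^ (2 ^ n * x + 2 ^ n * (2 * y)) = a ^ (2 ^ n * x) := by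
    intro x y; rw [keq]; exact ⟨y, by ring⟩
  have hs : g * g = 1 ∨ g * g = a ^ ((2:ℤ) ^ n) := by
    rw [← hi]
    rcases Int.even_or_odd' s with ⟨y, rfl | rfl⟩
    · left; rw [key]; exact ⟨y, by ring⟩
    · right; rw [keq]; exact ⟨y, by ring⟩
  rcases Int.even_or_odd' t with ⟨y, rfl | rfl⟩
  · -- k = -1
    have hga : g * a * g⁻¹ = a ^ (-1 : ℤ) := by
      rw [hk, keq]; exact ⟨y, by linear_combination ht⟩
    rcases hs with hs | hs
    · right; left
      have hn2 : 2 ≤ n := by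
        by_contra h0
        obtain rfl : n = 1 := by omega
        have hz : orderOf (a ^ 2) = 2 := by
          rw [orderOf_pow, ha]; norm_num
        have ha4 : a ^ 4 = 1 := by
          have := pow_orderOf_eq_one a
          rwa [ha] at this
        have hzm : a ^ 2 ∈ Subgroup.closure {a ^ 2, g} := Subgroup.subset_closure (by simp)
        have hgm : g ∈ Subgroup.closure {a ^ 2, g} := Subgroup.subset_closure (by simp)
        have hgz : g * a ^ 2 * g⁻¹ = a ^ 2 := by
          have := aux_conj_zpow hga 2
          rw [zpow_ofNat] at this
          rw [this, ← zpow_ofNat, keq]; norm_num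
        have hgz' : g * a ^ 2 = a ^ 2 * g := by rwa [mul_inv_eq_iff_eq_mul] at hgz
        have hcase : ∀ x, ∃ e : ℤ, x = a ^ e ∨ x = g * a ^ e := by
          intro x
          rcases hall x with ⟨e, he⟩ | ⟨e, he⟩ <;> simp only at he
          · exact ⟨e, Or.inl he.symm⟩
          · exact ⟨e, Or.inr (by rw [he]; group)⟩
        have hag : ∀ e : ℤ, a ^ e * g * (a ^ e)⁻¹ = (a ^ 2) ^ e * g := by
          intro e
          have := aux_conj_zpow hga (-e)
          rw [mul_inv_eq_iff_eq_mul] at this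
          rw [mul_assoc, ← zpow_neg, this, ← mul_assoc, ← zpow_add, ← zpow_ofNat, ← zpow_mul]
          congr 2; ring
        have := aux_noncyc hR (p := 2) (by norm_num) hz (w := g) (by rw [sq, hs]) hgz'.symm ?_ ?_
        · exact hg (Subgroup.zpowers_le.mpr (pow_mem (Subgroup.mem_zpowers a) 2) this)
        · intro x
          obtain ⟨e, rfl | rfl⟩ := hcase x
          · convert hzm using 1; group
          · convert hzm using 1
            calc g * a ^ e * a ^ 2 * (g * a ^ e)⁻¹ = g * a ^ 2 * g⁻¹ := by group
              _ = a ^ 2 := hgz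
        · intro x
          obtain ⟨e, rfl | rfl⟩ := hcase x
          · rw [hag]; exact mul_mem (zpow_mem hzm e) hgm
          · rw [show g * a ^ e * g * (g * a ^ e)⁻¹ = g * (a ^ e * g * (a ^ e)⁻¹) * g⁻¹ by group, hag]
            exact mul_mem (mul_mem hgm (mul_mem (zpow_mem hzm e) hgm)) (inv_mem hgm)
      exact ⟨n + 2, by omega, iso_dih ha hg hall hga hs⟩
    · left
      refine ⟨n + 2, by omega, iso_quat (N := 2 ^ n) ?_ hg hall hga ?_⟩
      · rw [ha, pow_succ']
      · rw [hs]; push_cast; rfl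
  · -- semidihedral
    right; right
    have hn2 : 2 ≤ n := by
      by_contra h0
      obtain rfl : n = 1 := by omega
      omega
    have hnat : ((2 ^ (n + 2 - 2) - 1 : ℕ) : ℤ) = 2 ^ n - 1 := by
      have : 1 ≤ 2 ^ (n + 2 - 2) := Nat.one_le_two_pow
      push_cast [this]; simp
    have hga : g * a * g⁻¹ = a ^ (2 ^ (n + 2 - 2) - 1) := by
      rw [← zpow_natCast, hnat, hk, keq]; exact ⟨y, by linear_combination ht⟩
    have hga' : g * a * g⁻¹ = a ^ ((2:ℤ) ^ n - 1) := by
      rw [hga, ← zpow_natCast, hnat]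
    rcases hs with hs | hs
    · exact ⟨n + 2, by omega, iso_sd ha hg hall hga hs⟩
    · refine ⟨n + 2, by omega, iso_sd (g := a * g) ha ?_ ?_ ?_ ?_⟩
      · rwa [Subgroup.mul_mem_cancel_left _ (Subgroup.mem_zpowers a)]
      · intro x
        rcases hall x with h | h
        · exact Or.inl h
        · right
          have := mul_mem (hN.conj_mem _ (inv_mem (Subgroup.mem_zpowers a)) g⁻¹) h
          convert this using 1; group
      · rw [← hga]
        have : a * g * a * (a * g)⁻¹ = a * (g * a * g⁻¹) * a⁻¹ := by group
        rw [this, hga']; group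
      · have : a * g * (a * g) = a * (g * a * g⁻¹) * (g * g) := by group
        rw [this, hga', hs, ← zpow_one_add, ← zpow_add, key]
        exact ⟨1, by ring⟩

theorem roquette_classification (p : ℕ) (hp : p.Prime)
    (G : Type) [Group G] [Fintype G] (hG : IsPGroup p G) :
    (∀ A : Subgroup G, A.Normal → (∀ x ∈ A, ∀ y ∈ A, x * y = y * x) → IsCyclic A) ↔
      ((∃ m : ℕ, Nonempty (G ≃* Multiplicative (ZMod (p ^ m)))) ∨
        (∃ m : ℕ, 3 ≤ m ∧ Nonempty (G ≃* QuaternionGroup (2 ^ (m - 2)))) ∨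
        (∃ m : ℕ, 4 ≤ m ∧ Nonempty (G ≃* DihedralGroup (2 ^ (m - 1)))) ∨
        (∃ m : ℕ, 4 ≤ m ∧ Nonempty (G ≃* SemidihedralGroup m))) := by
  constructor
  · exact roq_fwd hp hG
  · rintro (⟨m, ⟨e⟩⟩ | ⟨m, hm, ⟨e⟩⟩ | ⟨m, hm, ⟨e⟩⟩ | ⟨m, hm, ⟨e⟩⟩)
    · exact roq_equiv e roq_cyc
    · exact roq_equiv e (roq_quat m hm)
    · exact roq_equiv e (roq_dih m hm)
    · exact roq_equiv e (roq_sd m hm)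

end Genotype
end
end
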